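/- Let i ∈ I be a player, let 𝒟^i be a partition of the set of states S that satisfies Property P' with respect to player i, and let c^i ∈ ℝ^{𝒟^i} satisfy c^i(D) ≥ overline-v^i_1(s) for every element D ∈ 𝒟^i and every state s ∈ D. Then for every initial state s₀ ∈ S the limit lim_{λ→1} overline-v̂^i_λ(s₀;𝒟^i,c^i) exists and equals overline-v^i_1(s₀), where overline-v̂^i_λ(s₀;𝒟^i,c^i) := min_{σ^{-i}∈Σ^{-i}} max_{σ^i∈Σ^i} γ̂^i_λ(s₀,σ;𝒟^i,c^i) is the min-max value of player i in the modified game. -/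

import Mathlib

open MeasureTheory Filter Topology
open scoped ENNReal

noncomputable section

/-- A finite stochastic game: a finite set of players `I`, a finite set of states `S`,
finite nonempty action sets `A i s`, stage payoffs `u` bounded by `1` in absolute value,
and transition probabilities `q`. -/
structure StocGame where
  (I : Type)
  (S : Type)
  (A : I → S → Type)
  [fintypeI : Fintype I]
  [fintypeS : Fintype S]
  [decI : DecidableEq I]
  [decS : DecidableEq S]
  [fintypeA : ∀ i s, Fintype (A i s)]
  [decA : ∀ i s, DecidableEq (A i s)]
  [nonemptyA : ∀ i s, Nonempty (A i s)]
  (u : I → (s : S) → ((j : I) → A j s) → ℝ)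
  (u_bdd : ∀ i s a, |u i s a| ≤ 1)
  (q : (s : S) → ((j : I) → A j s) → S → ℝ)
  (q_nonneg : ∀ s a s', 0 ≤ q s a s')
  (q_sum : ∀ s a, ∑ s', q s a s' = 1)

namespace StocGame

attribute [instance] fintypeI fintypeS decI decS fintypeA decA nonemptyA

/-- A mixed action over a finite set of actions. -/
abbrev Mixed (α : Type) [Fintype α] : Type := {f : α → ℝ // (∀ a, 0 ≤ f a) ∧ ∑ a, f a = 1}

variable {G : StocGame}

/-- Action profiles available at state `s`. -/
abbrev Prof (G : StocGame) (s : G.S) : Type := (j : G.I) → G.A j s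

/-- A pair of a state together with an action profile at that state. -/
abbrev Step (G : StocGame) : Type := Σ s : G.S, G.Prof s

/-- A finite history: a (reversed) list of past (state, action profile) steps,
together with the current state. -/
abbrev Hist (G : StocGame) : Type := List G.Step × G.S

/-- A behavior strategy of player `i`. -/
abbrev BStrat (G : StocGame) (i : G.I) : Type := (h : G.Hist) → Mixed (G.A i h.2)

/-- A (behavior) strategy profile. -/
abbrev Profile (G : StocGame) : Type := (i : G.I) → G.BStrat i

/-- A stationary strategy of player `i`. -/
abbrev Stat (G : StocGame) (i : G.I) : Type := (s : G.S) → Mixed (G.A i s)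

/-- A stationary strategy profile. -/
abbrev StatProf (G : StocGame) : Type := (i : G.I) → G.Stat i

/-- The behavior strategy profile induced by a stationary strategy profile. -/
def toB (x : G.StatProf) : G.Profile := fun i h => x i h.2

/-- The behavior strategy induced by a stationary strategy. -/
def toB1 {i : G.I} (x : G.Stat i) : G.BStrat i := fun h => x h.2

/-- A stationary strategy profile is pure if at every state each player
puts probability `1` on a single action. -/
def IsPureStat (x : G.StatProf) : Prop :=
  ∀ (i : G.I) (s : G.S), ∃ a : G.A i s, ∀ b, (x i s).1 b = if b = a then 1 else 0

/-- The probability, under strategy profile `σ` and initial state `s0`, that the play follows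
the finite history whose (reversed) list of steps is the first argument and whose current
state is the second argument. -/
def probHistAux (s0 : G.S) (σ : G.Profile) : List G.Step → G.S → ℝ
  | [], s => if s = s0 then 1 else 0
  | ⟨s', a⟩ :: rest, s =>
      probHistAux s0 σ rest s' * (∏ i, (σ i (rest, s')).1 (a i)) * G.q s' a s

/-- The probability that the play follows the finite history `h`. -/
def probHist (s0 : G.S) (σ : G.Profile) (h : G.Hist) : ℝ := probHistAux s0 σ h.1 h.2

/-- The expected `lam`-discounted time `t_lam(s0,σ;s,a)` that the play spends at the
state-action pair `st = (s,a)`. -/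
def tStep (lam : ℝ) (s0 : G.S) (σ : G.Profile) (st : G.Step) : ℝ :=
  (1 - lam) *
    ∑' h : G.Hist, (if h.1.head? = some st then lam ^ (h.1.length - 1) * probHist s0 σ h else 0)

/-- The expected `lam`-discounted time that the play spends in the set of states `D`. -/
def tSet (lam : ℝ) (s0 : G.S) (σ : G.Profile) (D : Finset G.S) : ℝ :=
  ∑ st : G.Step, if st.1 ∈ D then tStep lam s0 σ st else 0

/-- The `lam`-discounted (unnormalized) payoff `U^i_lam(s0,σ;D)` that player `i` receives
while the play is in `D`. -/
def UD (lam : ℝ) (s0 : G.S) (σ : G.Profile) (i : G.I) (D : Finset G.S) : ℝ :=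
  ∑ st : G.Step, if st.1 ∈ D then tStep lam s0 σ st * G.u i st.1 st.2 else 0

/-- The `lam`-discounted payoff of player `i`. -/
def payoffD (lam : ℝ) (s0 : G.S) (σ : G.Profile) (i : G.I) : ℝ :=
  ∑ st : G.Step, tStep lam s0 σ st * G.u i st.1 st.2

/-- `Di` is a partition of the set of states. -/
def IsPartitionF (Di : Finset (Finset G.S)) : Prop :=
  ∀ s : G.S, ∃! D : Finset G.S, D ∈ Di ∧ s ∈ D

/-- The payoff of player `i` in the modified game, given the partition `Di` and
the cutoffs `c`. -/
def modPayoff (lam : ℝ) (s0 : G.S) (σ : G.Profile) (i : G.I)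
    (Di : Finset (Finset G.S)) (c : Finset G.S → ℝ) : ℝ :=
  ∑ D ∈ Di, min (UD lam s0 σ i D) (tSet lam s0 σ D * c D)

/-- The `lam`-discounted min-max value of player `i` in the original game. -/
def minmaxOrig (G : StocGame) (lam : ℝ) (s0 : G.S) (i : G.I) : ℝ :=
  ⨅ σ : G.Profile, ⨆ σi : G.BStrat i, payoffD lam s0 (Function.update σ i σi) i

/-- The `lam`-discounted max-min value of player `i` in the original game. -/
def maxminOrig (G : StocGame) (lam : ℝ) (s0 : G.S) (i : G.I) : ℝ :=
  ⨆ σi : G.BStrat i, ⨅ σ : G.Profile, payoffD lam s0 (Function.update σ i σi) i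

/-- The min-max value of player `i` in the modified game. -/
def minmaxMod (G : StocGame) (lam : ℝ) (s0 : G.S) (i : G.I)
    (Di : Finset (Finset G.S)) (c : Finset G.S → ℝ) : ℝ :=
  ⨅ σ : G.Profile, ⨆ σi : G.BStrat i,
    modPayoff lam s0 (Function.update σ i σi) i Di c

/-- The max-min value of player `i` in the modified game. -/
def maxminMod (G : StocGame) (lam : ℝ) (s0 : G.S) (i : G.I)
    (Di : Finset (Finset G.S)) (c : Finset G.S → ℝ) : ℝ :=
  ⨆ σi : G.BStrat i, ⨅ σ : G.Profile,
    modPayoff lam s0 (Function.update σ i σi) i Di c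

/-- The min-max value in stationary strategies of player `i` in the modified game. -/
def minmaxModStat (G : StocGame) (lam : ℝ) (s0 : G.S) (i : G.I)
    (Di : Finset (Finset G.S)) (c : Finset G.S → ℝ) : ℝ :=
  ⨅ x : G.StatProf, ⨆ xi : G.Stat i,
    modPayoff lam s0 (Function.update (toB x) i (toB1 xi)) i Di c

/-- The max-min value in stationary strategies of player `i` in the modified game. -/
def maxminModStat (G : StocGame) (lam : ℝ) (s0 : G.S) (i : G.I)
    (Di : Finset (Finset G.S)) (c : Finset G.S → ℝ) : ℝ :=
  ⨆ xi : G.Stat i, ⨅ x : G.StatProf,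
    modPayoff lam s0 (Function.update (toB x) i (toB1 xi)) i Di c

/-! ### Plays and the induced measure -/

/-- A play: the infinite sequence of (state, action profile) pairs. -/
abbrev Play (G : StocGame) : Type := ℕ → G.Step

instance : MeasurableSpace G.Step := ⊤

/-- The finite history consisting of the first `n` stages of the play `p`
(reversed list of the first `n` steps, together with the state at stage `n`). -/
def histOf (p : G.Play) : ℕ → G.Hist
  | 0 => ([], (p 0).1)
  | n + 1 => ((p n) :: (histOf p n).1, (p (n + 1)).1)

/-- The cylinder set of plays whose initial segment is the finite history `h`. -/
def cylSet (h : G.Hist) : Set G.Play := {p | histOf p h.1.length = h}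

/-- `μfam` is the family of probability measures on plays induced (via the
Ionescu–Tulcea theorem) by the initial state and the strategy profile:
it is characterized by being a probability measure giving each cylinder set
the probability of the corresponding finite history. -/
def IsInduced (μfam : G.S → G.Profile → Measure G.Play) : Prop :=
  (∀ s0 σ, IsProbabilityMeasure (μfam s0 σ)) ∧
  ∀ (s0 : G.S) (σ : G.Profile) (h : G.Hist),
    μfam s0 σ (cylSet h) = ENNReal.ofReal (probHist s0 σ h)

/-- A bounded stopping time (with respect to the filtration generated by finite histories). -/
def IsBddST (τ : G.Play → ℕ) : Prop :=
  (∃ B, ∀ p, τ p ≤ B) ∧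
  ∀ p p' n, τ p = n → histOf p n = histOf p' n → τ p' = n

/-- Two states lie in the same element of the partition `Di`. -/
def sameOf (Di : Finset (Finset G.S)) (s s' : G.S) : Prop := ∃ D ∈ Di, s ∈ D ∧ s' ∈ D

open Classical in
/-- The number of switches between elements of a partition along a play,
where the partition is described through the relation `r` ("being in the same element"). -/
def Zsw (r : G.S → G.S → Prop) (p : G.Play) : ℝ≥0∞ :=
  ∑' n : ℕ, if r (p n).1 (p (n + 1)).1 then 0 else 1

/-- The stopping times `τ^𝒟_k` indicating when the play moves from one element of
the partition (described by the relation `r`) to another. -/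
def switchT (r : G.S → G.S → Prop) (p : G.Play) : ℕ → ℕ∞
  | 0 => 0
  | k + 1 => sInf {n : ℕ∞ | ∃ m : ℕ, n = (m : ℕ∞) ∧ switchT r p k < (m : ℕ∞) ∧
      ¬ r (p (m - 1)).1 (p m).1}

/-- The expected average payoff of player `i` in the `N`-stage game. -/
def payoffN (μfam : G.S → G.Profile → Measure G.Play) (N : ℕ) (s0 : G.S)
    (σ : G.Profile) (i : G.I) : ℝ :=
  (∫ p, (∑ n ∈ Finset.range N, G.u i (p n).1 (p n).2) ∂(μfam s0 σ)) / N

/-- `σi` is a uniform `ε`-max-min strategy of player `i` (with respect to the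
uniform max-min value function `v`). -/
def UnifMaxMin (μfam : G.S → G.Profile → Measure G.Play) (v : G.S → ℝ) (i : G.I)
    (σi : G.BStrat i) (ε : ℝ) : Prop :=
  ∃ lam0 : ℝ, 0 ≤ lam0 ∧ lam0 < 1 ∧ ∃ N0 : ℕ,
    ∀ (s0 : G.S) (σ : G.Profile),
      (∀ lam : ℝ, lam0 < lam → lam < 1 →
        v s0 - ε ≤ payoffD lam s0 (Function.update σ i σi) i) ∧
      (∀ τ : G.Play → ℕ, IsBddST τ →
        (N0 : ℝ) ≤ ∫ p, (τ p : ℝ) ∂(μfam s0 (Function.update σ i σi)) →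
        (v s0 - ε) * ∫ p, (τ p : ℝ) ∂(μfam s0 (Function.update σ i σi)) ≤
          ∫ p, (∑ n ∈ Finset.range (τ p), G.u i (p n).1 (p n).2)
            ∂(μfam s0 (Function.update σ i σi)))

/-- `σi` is `(𝒟,ε)`-max-min preserving, where the partition `𝒟` is described by the
relation `r`, and the conditional-expectation requirement is expressed through
integrals over the atoms (cylinder sets) of the σ-algebra of the stopping time `τ^𝒟_k`. -/
def PreservingPart (μfam : G.S → G.Profile → Measure G.Play) (v : G.S → ℝ)
    (r : G.S → G.S → Prop) (i : G.I) (σi : G.BStrat i) (ε : ℝ) : Prop :=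
  ∀ (s0 : G.S) (σ : G.Profile) (k : ℕ) (τ' : G.Play → ℕ), IsBddST τ' →
    (∀ p, switchT r p k ≠ ⊤ →
      switchT r p k < (τ' p : ℕ∞) ∧ (τ' p : ℕ∞) ≤ switchT r p (k + 1)) →
    ∀ h : G.Hist, (∀ p ∈ cylSet h, switchT r p k = (h.1.length : ℕ∞)) →
      ∫ p in cylSet h, (v h.2 - ε) ∂(μfam s0 (Function.update σ i σi)) ≤
        ∫ p in cylSet h, v ((p (τ' p)).1) ∂(μfam s0 (Function.update σ i σi))

/-- `σi` is `ε`-max-min preserving (with respect to arbitrary bounded stopping times);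
again the conditional-expectation requirement is expressed through integrals over the
atoms of the σ-algebra of the stopping time `τ`. -/
def PreservingST (μfam : G.S → G.Profile → Measure G.Play) (v : G.S → ℝ) (i : G.I)
    (σi : G.BStrat i) (ε : ℝ) : Prop :=
  ∀ (s0 : G.S) (σ : G.Profile) (τ τ' : G.Play → ℕ), IsBddST τ → IsBddST τ' →
    (∀ p, τ p < τ' p) →
    ∀ h : G.Hist, (∀ p ∈ cylSet h, τ p = h.1.length) →
      ∫ p in cylSet h, (v h.2 - ε) ∂(μfam s0 (Function.update σ i σi)) ≤
        ∫ p in cylSet h, v ((p (τ' p)).1) ∂(μfam s0 (Function.update σ i σi))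

/-- A history enters a new element of the partition (described by `r`) at its final stage. -/
def entersNew (r : G.S → G.S → Prop) (h : G.Hist) : Prop :=
  match h.1 with
  | [] => True
  | st :: _ => ¬ r st.1 h.2

/-- `σi` is `𝒟`-Markovian: its continuation strategy coincides after any two finite histories
that end at the same state and whose final stage enters a new element of the partition
(described by `r`). -/
def Markovian (r : G.S → G.S → Prop) {i : G.I} (σi : G.BStrat i) : Prop :=
  ∀ h h' : G.Hist, h.2 = h'.2 → entersNew r h → entersNew r h' →
    ∀ (l : List G.Step) (s'' : G.S), σi (l ++ h.1, s'') = σi (l ++ h'.1, s'')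

open Classical in
/-- The portion of the history since the last time the play entered a new element of the
partition (described by `r`): (reversed) list of steps, given the current state. -/
def philist (r : G.S → G.S → Prop) : List G.Step → G.S → List G.Step
  | [], _ => []
  | st :: rest, s => if r st.1 s then st :: philist r rest st.1 else []

/-- The restart strategy `σ^i_𝒟`: whenever the play enters a new element of the partition
(described by `r`), player `i` forgets past play and restarts playing `σi`. -/
def restart {i : G.I} (σi : G.BStrat i) (r : G.S → G.S → Prop) : G.BStrat i :=
  fun h => σi (philist r h.1 h.2, h.2)

/-- The partition `Di` satisfies Property P with respect to player `i`
(whose uniform max-min value function is `v`). -/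
def PropertyP (μfam : G.S → G.Profile → Measure G.Play) (v : G.S → ℝ) (i : G.I)
    (Di : Finset (Finset G.S)) : Prop :=
  ∃ ζ : ℝ, 0 < ζ ∧ ∀ ε : ℝ, 0 < ε → ∃ σi : G.BStrat i,
    Markovian (sameOf Di) σi ∧ UnifMaxMin μfam v i σi ε ∧
    ∀ (s0 : G.S) (σ : G.Profile), ∃ E : Set G.Play,
      ENNReal.ofReal (1 - ε) < μfam s0 (Function.update σ i σi) E ∧
      ∫⁻ p in E, Zsw (sameOf Di) p ∂(μfam s0 (Function.update σ i σi)) ≤ ENNReal.ofReal ζ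

/-- The strategy profile `σ` (whose `i`-th coordinate is the strategy of player `i`) makes
player `i`'s strategy a uniform `𝒟`-subgame-perfect `ε`-min-max strategy against the others'
strategies, at the initial state `s0`; `vbar` is the uniform min-max value function of
player `i`, and the partition `𝒟` is described by the relation `r`.  Conditional-expectation
requirements are expressed through integrals over the atoms (cylinder sets) of the σ-algebra
of the stopping time `τ^𝒟_k`. -/
def SubgamePerfect (μfam : G.S → G.Profile → Measure G.Play) (vbar : G.S → ℝ)
    (r : G.S → G.S → Prop) (i : G.I) (σ : G.Profile) (s0 : G.S) (ε : ℝ) : Prop :=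
  ∃ N0 : ℕ, 0 < N0 ∧
    (∀ N : ℕ, N0 ≤ N → vbar s0 - ε ≤ payoffN μfam N s0 σ i) ∧
    (∀ (k : ℕ) (τ : G.Play → ℕ), IsBddST τ → (∀ p, switchT r p k ≤ (τ p : ℕ∞)) →
      ∀ h : G.Hist, (∀ p ∈ cylSet h, switchT r p k = (h.1.length : ℕ∞)) →
        (∫ p in cylSet h, (vbar h.2 - ε) ∂(μfam s0 σ) ≤
          ∫ p in cylSet h, vbar ((p (τ p)).1) ∂(μfam s0 σ)) ∧
        ((N0 : ℝ) * (μfam s0 σ (cylSet h)).toReal ≤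
            ∫ p in cylSet h, ((τ p : ℝ) - (h.1.length : ℝ)) ∂(μfam s0 σ) →
          (vbar h.2 - ε) * ∫ p in cylSet h, ((τ p : ℝ) - (h.1.length : ℝ)) ∂(μfam s0 σ) ≤
            ∫ p in cylSet h, (∑ n ∈ Finset.Ico h.1.length (τ p), G.u i (p n).1 (p n).2)
              ∂(μfam s0 σ)))

/-- The partition `Di` satisfies Property P' with respect to player `i`
(whose uniform min-max value function is `vbar`). -/
def PropertyP' (μfam : G.S → G.Profile → Measure G.Play) (vbar : G.S → ℝ) (i : G.I)
    (Di : Finset (Finset G.S)) : Prop :=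
  ∃ ζ : ℝ, 0 < ζ ∧ ∀ ε : ℝ, 0 < ε → ∀ (s0 : G.S) (σ : G.Profile), ∃ σi : G.BStrat i,
    SubgamePerfect μfam vbar (sameOf Di) i (Function.update σ i σi) s0 ε ∧
    ∃ E : Set G.Play,
      ENNReal.ofReal (1 - ε) ≤ μfam s0 (Function.update σ i σi) E ∧
      ∫⁻ p in E, Zsw (sameOf Di) p ∂(μfam s0 (Function.update σ i σi)) ≤ ENNReal.ofReal ζ

/-! ### Reachability, closed and strongly controllable sets -/

/-- The first arrival time to the set of states `C`. -/
def hitT (C : Set G.S) (p : G.Play) : ℕ∞ :=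
  sInf {n : ℕ∞ | ∃ m : ℕ, n = (m : ℕ∞) ∧ (p m).1 ∈ C}

/-- State `s` leads in `D` to state `s'`. -/
def LeadsIn (μfam : G.S → G.Profile → Measure G.Play) (D : Set G.S) (s s' : G.S) : Prop :=
  ∃ σ : G.Profile, μfam s σ {p | hitT {s'} p < hitT Dᶜ p} = 1

/-- The states `s` and `s'` are `D`-siblings. -/
def Siblings (μfam : G.S → G.Profile → Measure G.Play) (D : Set G.S) (s s' : G.S) : Prop :=
  LeadsIn μfam D s s' ∧ LeadsIn μfam D s' s

/-- The probability `q(D | s, a)` that the next state lies in `D`. -/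
def qOf (D : Set G.S) (s : G.S) (a : G.Prof s) : ℝ := ∑ s', D.indicator (G.q s a) s'

/-- The set of states `D` is closed. -/
def ClosedSet (G : StocGame) (D : Set G.S) : Prop :=
  ∀ s ∈ D, ∀ a : G.Prof s, qOf D s a = 1

/-- The set of states `D` is strongly controllable. -/
def StronglyContr (G : StocGame) (D : Set G.S) : Prop :=
  ∃ iD : G.I, ∃ sD ∈ D, ∃ atil : G.A iD sD,
    ∀ s ∈ D, ∀ a : G.Prof s, qOf D s a < 1 → s = sD ∧ HEq (a iD) atil

/-- The element of the partition `𝒟` (by the vector of uniform min-max values `v`)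
that contains the state `s`. -/
def Dv (v : G.I → G.S → ℝ) (s : G.S) : Set G.S := {s' | ∀ i, v i s' = v i s}

/-- The element of the refined partition `𝒟*` (refining `𝒟` by the `D`-siblings relation)
that contains the state `s`. -/
def DstarCl (μfam : G.S → G.Profile → Measure G.Play) (v : G.I → G.S → ℝ) (s : G.S) :
    Set G.S := {s' | s' ∈ Dv v s ∧ Siblings μfam (Dv v s) s s'}

/-- The stochastic game is strongly controllable: every element of `𝒟*` is either closed
or strongly controllable. -/
def StronglyControllableGame (G : StocGame) (μfam : G.S → G.Profile → Measure G.Play)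
    (v : G.I → G.S → ℝ) : Prop :=
  ∀ s : G.S, ClosedSet G (DstarCl μfam v s) ∨ StronglyContr G (DstarCl μfam v s)

end StocGame

/-- A set `X ⊆ ℝ^ι` is monovex if every two points of `X` are connected by a continuous
path inside `X` all of whose coordinates are monotone. -/
def Monovex {ι : Type} (X : Set (ι → ℝ)) : Prop :=
  ∀ x ∈ X, ∀ y ∈ X, ∃ f : ℝ → ι → ℝ,
    ContinuousOn f (Set.Icc 0 1) ∧ (∀ t ∈ Set.Icc (0 : ℝ) 1, f t ∈ X) ∧
    f 0 = x ∧ f 1 = y ∧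
    ∀ j : ι, MonotoneOn (fun t => f t j) (Set.Icc 0 1) ∨
      AntitoneOn (fun t => f t j) (Set.Icc 0 1)

end

noncomputable section

namespace StocGame

variable {G : StocGame}

/-! ### The one-step expectation operator on functions of histories -/

/-- The probability that the action profile `a` is played after the history `h`. -/
def actProb (σ : G.Profile) (h : G.Hist) (a : G.Prof h.2) : ℝ := ∏ j, (σ j h).1 (a j)

/-- The history that extends `h` by the action profile `a` and the new state `s'`. -/
abbrev child (h : G.Hist) (a : G.Prof h.2) (s' : G.S) : G.Hist := (⟨h.2, a⟩ :: h.1, s')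

/-- The conditional expectation, given the history `h`, of `F` at the next history. -/
def step (σ : G.Profile) (F : G.Hist → ℝ) (h : G.Hist) : ℝ :=
  ∑ a : G.Prof h.2, actProb σ h a * ∑ s', G.q h.2 a s' * F (child h a s')

/-- The value of `f` at the last step of a history. -/
def lastVal (f : G.Step → ℝ) (h : G.Hist) : ℝ :=
  match h.1 with
  | [] => 0
  | st :: _ => f st

/-- The expected `lam`-discounted sum of `f` over the `n` stages that follow a history. -/
def partSum (lam : ℝ) (σ : G.Profile) (f : G.Step → ℝ) : ℕ → G.Hist → ℝ
  | 0 => fun _ => 0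
  | n + 1 => step σ (fun h => lastVal f h + lam * partSum lam σ f n h)

lemma actProb_nonneg (σ : G.Profile) (h : G.Hist) (a : G.Prof h.2) : 0 ≤ actProb σ h a :=
  Finset.prod_nonneg fun j _ => (σ j h).2.1 (a j)

lemma actProb_sum (σ : G.Profile) (h : G.Hist) : ∑ a, actProb σ h a = 1 := by
  have := Finset.prod_univ_sum (fun j : G.I => (Finset.univ : Finset (G.A j h.2)))
    (fun j x => (σ j h).1 x)
  rw [Fintype.piFinset_univ] at this
  unfold actProb
  rw [← this]
  exact Finset.prod_eq_one fun j _ => (σ j h).2.2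

lemma actProb_eq_zero (σ : G.Profile) (h : G.Hist) (a : G.Prof h.2) (i : G.I)
    (hi : ¬ 0 < (σ i h).1 (a i)) : actProb σ h a = 0 :=
  Finset.prod_eq_zero (Finset.mem_univ i) (le_antisymm (not_lt.1 hi) ((σ i h).2.1 _))

lemma step_le_step_of_supp (σ : G.Profile) (i : G.I) {F F' : G.Hist → ℝ} (h : G.Hist)
    (hF : ∀ a s', 0 < (σ i h).1 (a i) → 0 < G.q h.2 a s' → F (child h a s') ≤ F' (child h a s')) :
    step σ F h ≤ step σ F' h := by
  refine Finset.sum_le_sum fun a _ => ?_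
  by_cases ha : 0 < (σ i h).1 (a i)
  · refine mul_le_mul_of_nonneg_left (Finset.sum_le_sum fun s' _ => ?_) (actProb_nonneg σ h a)
    rcases (G.q_nonneg h.2 a s').eq_or_lt with hq | hq
    · simp [← hq]
    · exact mul_le_mul_of_nonneg_left (hF a s' ha hq) hq.le
  · simp [actProb_eq_zero σ h a i ha]

lemma step_le_step (σ : G.Profile) {F F' : G.Hist → ℝ} (h : G.Hist)
    (hF : ∀ a s', F (child h a s') ≤ F' (child h a s')) : step σ F h ≤ step σ F' h :=
  Finset.sum_le_sum fun a _ => mul_le_mul_of_nonneg_left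
    (Finset.sum_le_sum fun s' _ => mul_le_mul_of_nonneg_left (hF a s') (G.q_nonneg _ _ _))
    (actProb_nonneg σ h a)

lemma step_congr (σ : G.Profile) {F F' : G.Hist → ℝ} (h : G.Hist)
    (hF : ∀ a s', F (child h a s') = F' (child h a s')) : step σ F h = step σ F' h :=
  le_antisymm (step_le_step σ h fun a s' => (hF a s').le)
    (step_le_step σ h fun a s' => (hF a s').ge)

lemma step_const (σ : G.Profile) (c : ℝ) (h : G.Hist) : step σ (fun _ => c) h = c := by
  simp [step, ← Finset.sum_mul, G.q_sum, actProb_sum]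

lemma step_add (σ : G.Profile) (F F' : G.Hist → ℝ) (h : G.Hist) :
    step σ (fun h => F h + F' h) h = step σ F h + step σ F' h := by
  simp [step, mul_add, Finset.sum_add_distrib]

lemma step_const_mul (σ : G.Profile) (c : ℝ) (F : G.Hist → ℝ) (h : G.Hist) :
    step σ (fun h => c * F h) h = c * step σ F h := by
  simp only [step, Finset.mul_sum]
  refine Finset.sum_congr rfl fun a _ => Finset.sum_congr rfl fun s' _ => by ring

lemma const_le_step (σ : G.Profile) {F : G.Hist → ℝ} {c : ℝ} (h : G.Hist)
    (hF : ∀ a s', c ≤ F (child h a s')) : c ≤ step σ F h :=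
  (step_const σ c h).symm.trans_le (step_le_step σ h hF)

lemma mul_le_step_of_nonneg (σ : G.Profile) {F : G.Hist → ℝ} (h : G.Hist)
    (hF : ∀ a s', 0 ≤ F (child h a s')) (a : G.Prof h.2) (s' : G.S) :
    actProb σ h a * G.q h.2 a s' * F (child h a s') ≤ step σ F h := by
  have h1 : ∀ a, 0 ≤ ∑ s', G.q h.2 a s' * F (child h a s') := fun a =>
    Finset.sum_nonneg fun s' _ => mul_nonneg (G.q_nonneg _ _ _) (hF a s')
  refine le_trans ?_ (Finset.single_le_sum (f := fun a => actProb σ h a *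
    ∑ s', G.q h.2 a s' * F (child h a s'))
    (fun a _ => mul_nonneg (actProb_nonneg σ h a) (h1 a)) (Finset.mem_univ a))
  rw [mul_assoc]
  exact mul_le_mul_of_nonneg_left (Finset.single_le_sum
    (f := fun s' => G.q h.2 a s' * F (child h a s'))
    (fun s' _ => mul_nonneg (G.q_nonneg _ _ _) (hF a s')) (Finset.mem_univ s'))
    (actProb_nonneg σ h a)

lemma iterate_step_mono (σ : G.Profile) {F F' : G.Hist → ℝ} (n : ℕ) (hF : ∀ h, F h ≤ F' h)
    (h : G.Hist) : (step σ)^[n] F h ≤ (step σ)^[n] F' h := by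
  induction n generalizing h with
  | zero => exact hF h
  | succ n ih =>
    simp only [Function.iterate_succ_apply']
    exact step_le_step σ h fun a s' => ih _

lemma iterate_step_add (σ : G.Profile) (F F' : G.Hist → ℝ) (n : ℕ) (h : G.Hist) :
    (step σ)^[n] (fun h => F h + F' h) h = (step σ)^[n] F h + (step σ)^[n] F' h := by
  induction n generalizing h with
  | zero => rfl
  | succ n ih =>
    simp only [Function.iterate_succ_apply']
    rw [← step_add]
    exact step_congr σ h fun a s' => ih _

lemma iterate_step_const_mul (σ : G.Profile) (c : ℝ) (F : G.Hist → ℝ) (n : ℕ) (h : G.Hist) :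
    (step σ)^[n] (fun h => c * F h) h = c * (step σ)^[n] F h := by
  induction n generalizing h with
  | zero => rfl
  | succ n ih =>
    simp only [Function.iterate_succ_apply']
    rw [← step_const_mul]
    exact step_congr σ h fun a s' => ih _

lemma iterate_step_const (σ : G.Profile) (c : ℝ) (n : ℕ) (h : G.Hist) :
    (step σ)^[n] (fun _ => c) h = c := by
  induction n generalizing h with
  | zero => rfl
  | succ n ih =>
    simp only [Function.iterate_succ_apply']
    exact (step_congr σ h fun a s' => ih _).trans (step_const σ c h)

lemma abs_lastVal_le {f : G.Step → ℝ} {K : ℝ} (hf : ∀ st, |f st| ≤ K) (hK : 0 ≤ K) (h : G.Hist) :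
    |lastVal f h| ≤ K := by
  obtain ⟨l, s⟩ := h
  cases l with
  | nil => simpa [lastVal] using hK
  | cons st l => exact hf st

lemma partSum_split (lam : ℝ) (σ : G.Profile) (f : G.Step → ℝ) (m n : ℕ) (h : G.Hist) :
    partSum lam σ f (m + n) h =
      partSum lam σ f m h + lam ^ m * (step σ)^[m] (partSum lam σ f n) h := by
  induction m generalizing h with
  | zero => simp [partSum]
  | succ m ih =>
    rw [Nat.add_right_comm]
    simp only [partSum, Function.iterate_succ_apply']
    rw [← step_const_mul, ← step_add]
    refine step_congr σ h fun a s' => ?_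
    rw [ih]; ring

lemma partSum_add (lam : ℝ) (σ : G.Profile) (f f' : G.Step → ℝ) (n : ℕ) (h : G.Hist) :
    partSum lam σ (fun st => f st + f' st) n h = partSum lam σ f n h + partSum lam σ f' n h := by
  induction n generalizing h with
  | zero => simp [partSum]
  | succ n ih =>
    simp only [partSum]
    rw [← step_add]
    refine step_congr σ h fun a s' => ?_
    rw [ih]; simp only [lastVal]; ring

lemma partSum_const_mul (lam : ℝ) (σ : G.Profile) (c : ℝ) (f : G.Step → ℝ) (n : ℕ) (h : G.Hist) :
    partSum lam σ (fun st => c * f st) n h = c * partSum lam σ f n h := by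
  induction n generalizing h with
  | zero => simp [partSum]
  | succ n ih =>
    simp only [partSum]
    rw [← step_const_mul]
    refine step_congr σ h fun a s' => ?_
    rw [ih]; simp only [lastVal]; ring

lemma partSum_mono (σ : G.Profile) {f f' : G.Step → ℝ} (hf : ∀ st, f st ≤ f' st)
    (n : ℕ) (h : G.Hist) : partSum 1 σ f n h ≤ partSum 1 σ f' n h := by
  induction n generalizing h with
  | zero => simp [partSum]
  | succ n ih =>
    refine step_le_step σ h fun a s' => ?_
    have := ih (child h a s')
    have := hf ⟨h.2, a⟩
    simp only [lastVal, one_mul]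
    linarith

lemma partSum_one_const (σ : G.Profile) (c : ℝ) (n : ℕ) (h : G.Hist) :
    partSum 1 σ (fun _ => c) n h = n * c := by
  induction n generalizing h with
  | zero => simp [partSum]
  | succ n ih =>
    refine (step_congr σ (F' := fun _ => (n + 1 : ℕ) * c) h fun a s' => ?_).trans
      (step_const σ _ h)
    rw [ih]; simp only [lastVal]; push_cast; ring

lemma partSum_one_le (σ : G.Profile) {f : G.Step → ℝ} {K : ℝ} (hf : ∀ st, f st ≤ K)
    (n : ℕ) (h : G.Hist) : partSum 1 σ f n h ≤ n * K :=
  (partSum_mono σ hf n h).trans_eq (partSum_one_const σ K n h)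

/-! ### Sums over histories of a given length -/

/-- The finite set of histories of length `n`. -/
def histN (G : StocGame) (n : ℕ) : Finset G.Hist :=
  (List.finite_length_eq G.Step n).toFinset ×ˢ Finset.univ

lemma mem_histN {n : ℕ} {h : G.Hist} : h ∈ histN G n ↔ h.1.length = n := by
  simp [histN]

lemma sum_histN_succ (n : ℕ) (φ : G.Hist → ℝ) :
    ∑ h ∈ histN G (n + 1), φ h =
      ∑ h ∈ histN G n, ∑ a : G.Prof h.2, ∑ s', φ (child h a s') := by
  have h1 : ∀ h : G.Hist, ∑ a : G.Prof h.2, ∑ s', φ (child h a s') =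
      ∑ x : G.Prof h.2 × G.S, φ (child h x.1 x.2) := fun h =>
    (Fintype.sum_prod_type (f := fun x : G.Prof h.2 × G.S => φ (child h x.1 x.2))).symm
  simp only [h1]
  rw [Finset.sum_sigma']
  symm
  refine Finset.sum_bij (fun x _ => child x.1 x.2.1 x.2.2) ?_ ?_ ?_ ?_
  · rintro ⟨h, a, s'⟩ hx
    simp only [Finset.mem_sigma, mem_histN] at hx
    simp [mem_histN, hx.1]
  · rintro ⟨⟨l, s⟩, a, s'⟩ _ ⟨⟨l2, s2⟩, a2, s2'⟩ _ heq
    simp only [child, Prod.mk.injEq, List.cons.injEq, Sigma.mk.injEq] at heq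
    obtain ⟨⟨⟨rfl, h2⟩, rfl⟩, rfl⟩ := heq
    obtain rfl := eq_of_heq h2
    rfl
  · rintro ⟨l, s'⟩ hb
    rw [mem_histN] at hb
    match l, hb with
    | ⟨s, a⟩ :: l, hb =>
      refine ⟨⟨(l, s), a, s'⟩, ?_, rfl⟩
      simp only [Finset.mem_sigma, mem_histN, Finset.mem_univ, and_true]
      simpa using hb
  · intros; rfl

lemma sum_probHist_mul (s0 : G.S) (σ : G.Profile) (n : ℕ) (F : G.Hist → ℝ) :
    ∑ h ∈ histN G n, probHist s0 σ h * F h = (step σ)^[n] F ([], s0) := by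
  induction n generalizing F with
  | zero =>
    have h0 : histN G 0 = {[]} ×ˢ Finset.univ := by
      ext ⟨l, s⟩
      simp [mem_histN]
    simp [h0, probHist, probHistAux]
  | succ n ih =>
    rw [sum_histN_succ, Function.iterate_succ_apply, ← ih]
    refine Finset.sum_congr rfl fun h _ => ?_
    simp only [step, Finset.mul_sum]
    refine Finset.sum_congr rfl fun a _ => Finset.sum_congr rfl fun s' _ => ?_
    simp only [probHist, probHistAux, actProb]
    ring

lemma probHist_nonneg (s0 : G.S) (σ : G.Profile) (h : G.Hist) : 0 ≤ probHist s0 σ h := by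
  obtain ⟨l, s⟩ := h
  induction l generalizing s with
  | nil => simp only [probHist, probHistAux]; split_ifs <;> norm_num
  | cons st l ih =>
    exact mul_nonneg (mul_nonneg (ih st.1) (actProb_nonneg σ (l, st.1) st.2)) (G.q_nonneg _ _ _)

/-! ### The induced measure -/

lemma length_histOf (p : G.Play) (n : ℕ) : (histOf p n).1.length = n := by
  induction n with
  | zero => rfl
  | succ n ih => simp [histOf, ih]

lemma histOf_snd (p : G.Play) (n : ℕ) : (histOf p n).2 = (p n).1 := by
  cases n <;> rfl

lemma measurableSet_histOf (n : ℕ) (A : Set G.Hist) : MeasurableSet {p | histOf p n ∈ A} := by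
  induction n generalizing A with
  | zero =>
    exact measurable_pi_apply (X := fun _ : ℕ => G.Step) 0
      (t := {st | (([] : List G.Step), st.1) ∈ A}) trivial
  | succ n ih =>
    have : {p : G.Play | histOf p (n + 1) ∈ A} = ⋃ st : G.Step, ⋃ s' : G.S,
        ({p | p n ∈ ({st} : Set G.Step)} ∩ {p | p (n + 1) ∈ {t : G.Step | t.1 = s'}}) ∩
          {p | histOf p n ∈ {h : G.Hist | (st :: h.1, s') ∈ A}} := by
      ext p
      simp only [Set.mem_ofPred_eq, Set.mem_iUnion, Set.mem_inter_iff, Set.mem_singleton_iff]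
      constructor
      · intro hp
        exact ⟨p n, (p (n + 1)).1, ⟨rfl, rfl⟩, hp⟩
      · rintro ⟨st, s', ⟨rfl, rfl⟩, hp⟩
        exact hp
    rw [this]
    refine MeasurableSet.iUnion fun st => MeasurableSet.iUnion fun s' => ?_
    exact ((measurable_pi_apply (X := fun _ : ℕ => G.Step) n (t := {st}) trivial).inter
      (measurable_pi_apply (X := fun _ : ℕ => G.Step) (n + 1) (t := {t | t.1 = s'}) trivial)).inter
      (ih _)

lemma histOf_eq_sum (n : ℕ) (F : G.Hist → ℝ) (p : G.Play) :
    F (histOf p n) = ∑ h ∈ histN G n, (cylSet h).indicator (fun _ => F h) p := by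
  rw [Finset.sum_eq_single (histOf p n)]
  · rw [Set.indicator_of_mem]
    simp [cylSet, length_histOf]
  · intro h hh hne
    rw [mem_histN] at hh
    rw [Set.indicator_of_notMem]
    simp only [cylSet, Set.mem_ofPred_eq, hh]
    exact fun h' => hne h'.symm
  · intro hh
    exact absurd (mem_histN.2 (length_histOf p n)) hh

lemma measurableSet_cylSet (h : G.Hist) : MeasurableSet (cylSet h) :=
  measurableSet_histOf h.1.length {h}

variable {μfam : G.S → G.Profile → Measure G.Play}

lemma integrable_histOf (hind : IsInduced μfam) (s0 : G.S) (σ : G.Profile) (n : ℕ)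
    (F : G.Hist → ℝ) : Integrable (fun p => F (histOf p n)) (μfam s0 σ) := by
  have := hind.1 s0 σ
  simp only [histOf_eq_sum n F]
  exact integrable_finsetSum _ fun h _ =>
    (integrable_const (F h)).indicator (measurableSet_cylSet h)

lemma integral_histOf (hind : IsInduced μfam) (s0 : G.S) (σ : G.Profile) (n : ℕ)
    (F : G.Hist → ℝ) : ∫ p, F (histOf p n) ∂(μfam s0 σ) = (step σ)^[n] F ([], s0) := by
  have := hind.1 s0 σ
  simp only [histOf_eq_sum n F]
  rw [integral_finsetSum _ fun h _ =>
    (integrable_const (F h)).indicator (measurableSet_cylSet h), ← sum_probHist_mul]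
  refine Finset.sum_congr rfl fun h _ => ?_
  rw [integral_indicator_const _ (measurableSet_cylSet h), Measure.real, hind.2,
    ENNReal.toReal_ofReal (probHist_nonneg _ _ _), smul_eq_mul]

/-! ### Discounted sums -/

/-- The expected normalized `lam`-discounted sum of `f` over the stages that follow a history. -/
def disc (lam : ℝ) (σ : G.Profile) (f : G.Step → ℝ) (h : G.Hist) : ℝ :=
  (1 - lam) * ∑' n : ℕ, lam ^ n * (step σ)^[n + 1] (lastVal f) h

lemma exists_abs_le (f : G.Step → ℝ) : ∃ K, 0 ≤ K ∧ ∀ st, |f st| ≤ K :=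
  ⟨∑ st, |f st|, Finset.sum_nonneg fun _ _ => abs_nonneg _, fun st =>
    Finset.single_le_sum (f := fun st => |f st|) (fun _ _ => abs_nonneg _) (Finset.mem_univ st)⟩

lemma abs_iterate_step_le (σ : G.Profile) {f : G.Step → ℝ} {K : ℝ} (hf : ∀ st, |f st| ≤ K)
    (hK : 0 ≤ K) (n : ℕ) (h : G.Hist) : |(step σ)^[n] (lastVal f) h| ≤ K := by
  rw [abs_le]
  constructor
  · have := iterate_step_mono σ n (F := fun _ => -K) (F' := lastVal f)
      (fun h => (abs_le.1 (abs_lastVal_le hf hK h)).1) h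
    rwa [iterate_step_const] at this
  · have := iterate_step_mono σ n (F' := fun _ => K) (F := lastVal f)
      (fun h => (abs_le.1 (abs_lastVal_le hf hK h)).2) h
    rwa [iterate_step_const] at this

lemma summable_disc {lam : ℝ} (h0 : 0 ≤ lam) (h1 : lam < 1) (σ : G.Profile) (f : G.Step → ℝ)
    (h : G.Hist) : Summable fun n : ℕ => lam ^ n * (step σ)^[n + 1] (lastVal f) h := by
  obtain ⟨K, hK, hf⟩ := exists_abs_le f
  refine Summable.of_norm_bounded ((summable_geometric_of_lt_one h0 h1).mul_right K) fun n => ?_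
  rw [Real.norm_eq_abs, abs_mul, abs_of_nonneg (pow_nonneg h0 n)]
  exact mul_le_mul_of_nonneg_left (abs_iterate_step_le σ hf hK _ h) (pow_nonneg h0 n)

lemma lastVal_add (f f' : G.Step → ℝ) :
    lastVal (fun st => f st + f' st) = fun h => lastVal f h + lastVal f' h := by
  ext ⟨l, s⟩
  cases l <;> simp [lastVal]

lemma lastVal_const_mul (c : ℝ) (f : G.Step → ℝ) :
    lastVal (fun st => c * f st) = fun h => c * lastVal f h := by
  ext ⟨l, s⟩
  cases l <;> simp [lastVal]

lemma disc_add {lam : ℝ} (h0 : 0 ≤ lam) (h1 : lam < 1) (σ : G.Profile) (f f' : G.Step → ℝ)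
    (h : G.Hist) :
    disc lam σ (fun st => f st + f' st) h = disc lam σ f h + disc lam σ f' h := by
  unfold disc
  rw [← mul_add, ← (summable_disc h0 h1 σ f h).tsum_add (summable_disc h0 h1 σ f' h)]
  congr 1
  refine tsum_congr fun n => ?_
  rw [← mul_add, ← iterate_step_add, lastVal_add]

lemma disc_const_mul (lam : ℝ) (σ : G.Profile) (c : ℝ) (f : G.Step → ℝ) (h : G.Hist) :
    disc lam σ (fun st => c * f st) h = c * disc lam σ f h := by
  have h2 : ∀ n, lam ^ n * (step σ)^[n + 1] (lastVal fun st => c * f st) h =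
      c * (lam ^ n * (step σ)^[n + 1] (lastVal f) h) := fun n => by
    rw [lastVal_const_mul, iterate_step_const_mul, mul_left_comm]
  simp only [disc, h2, tsum_mul_left, mul_left_comm]

lemma disc_sum {lam : ℝ} (h0 : 0 ≤ lam) (h1 : lam < 1) (σ : G.Profile) {ι : Type*}
    (t : Finset ι) (f : ι → G.Step → ℝ) (h : G.Hist) :
    disc lam σ (fun st => ∑ x ∈ t, f x st) h = ∑ x ∈ t, disc lam σ (f x) h := by
  classical
  induction t using Finset.induction_on with
  | empty => simpa using disc_const_mul lam σ 0 (fun _ => 0) h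
  | insert x t hx ih => simp only [Finset.sum_insert hx]; rw [disc_add h0 h1, ih]

lemma disc_succ {lam : ℝ} (h0 : 0 ≤ lam) (h1 : lam < 1) (σ : G.Profile) (f : G.Step → ℝ)
    (h : G.Hist) :
    disc lam σ f h = step σ (fun h' => (1 - lam) * lastVal f h' + lam * disc lam σ f h') h := by
  have hs : HasSum (fun n : ℕ => lam ^ n * (step σ)^[n + 1 + 1] (lastVal f) h)
      (step σ (fun h' => ∑' n : ℕ, lam ^ n * (step σ)^[n + 1] (lastVal f) h') h) := by
    simp only [Function.iterate_succ_apply' _ (_ + 1), ← step_const_mul]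
    refine hasSum_sum fun a _ => HasSum.mul_left _ (hasSum_sum fun s' _ => HasSum.mul_left _ ?_)
    exact (summable_disc h0 h1 σ f _).hasSum
  rw [step_add, step_const_mul, step_const_mul]
  have h2 := (summable_disc h0 h1 σ f h).tsum_eq_zero_add
  have h3 : (fun n : ℕ => lam ^ (n + 1) * (step σ)^[n + 1 + 1] (lastVal f) h) =
      fun n : ℕ => lam * (lam ^ n * (step σ)^[n + 1 + 1] (lastVal f) h) := by
    ext n; ring
  rw [h3, tsum_mul_left, hs.tsum_eq] at h2
  have h4 : step σ (disc lam σ f) h = (1 - lam) *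
      step σ (fun h' => ∑' n : ℕ, lam ^ n * (step σ)^[n + 1] (lastVal f) h') h := by
    rw [← step_const_mul]; rfl
  rw [h4, disc, h2]
  simp only [pow_zero, zero_add, Function.iterate_one]
  ring

lemma disc_one {lam : ℝ} (h0 : 0 ≤ lam) (h1 : lam < 1) (σ : G.Profile) (h : G.Hist) :
    disc lam σ (fun _ => 1) h = 1 := by
  have : ∀ n : ℕ, (step σ)^[n + 1] (lastVal fun _ : G.Step => (1 : ℝ)) h = 1 := fun n => by
    rw [Function.iterate_succ_apply]
    have : step σ (lastVal fun _ : G.Step => (1 : ℝ)) = fun _ => 1 := by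
      ext h
      exact (step_congr σ h fun _ _ => rfl).trans (step_const σ 1 h)
    rw [this, iterate_step_const]
  simp only [disc, this, mul_one, tsum_geometric_of_lt_one h0 h1]
  exact mul_inv_cancel₀ (by linarith)

lemma disc_nonneg {lam : ℝ} (h0 : 0 ≤ lam) (h1 : lam < 1) (σ : G.Profile) {f : G.Step → ℝ}
    (hf : ∀ st, 0 ≤ f st) (h : G.Hist) : 0 ≤ disc lam σ f h := by
  refine mul_nonneg (by linarith) (tsum_nonneg fun n => mul_nonneg (pow_nonneg h0 n) ?_)
  have := iterate_step_mono σ (n + 1) (F := fun _ => 0) (F' := lastVal f) (fun ⟨l, s⟩ => by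
    cases l with
    | nil => exact le_rfl
    | cons st l => exact hf st) h
  rwa [iterate_step_const] at this

lemma disc_mono {lam : ℝ} (h0 : 0 ≤ lam) (h1 : lam < 1) (σ : G.Profile) {f f' : G.Step → ℝ}
    (hf : ∀ st, f st ≤ f' st) (h : G.Hist) : disc lam σ f h ≤ disc lam σ f' h := by
  have h2 := disc_add h0 h1 σ f (fun st => f' st - f st) h
  have h3 := disc_nonneg h0 h1 σ (f := fun st => f' st - f st) (fun st => sub_nonneg.2 (hf st)) h
  simp only [add_sub_cancel] at h2
  linarith

lemma disc_const {lam : ℝ} (h0 : 0 ≤ lam) (h1 : lam < 1) (σ : G.Profile) (c : ℝ) (h : G.Hist) :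
    disc lam σ (fun _ => c) h = c := by
  have := disc_const_mul lam σ c (fun _ => 1) h
  rwa [disc_one h0 h1, mul_one] at this

lemma tStep_eq_disc {lam : ℝ} (h0 : 0 ≤ lam) (h1 : lam < 1) (s0 : G.S) (σ : G.Profile)
    (st : G.Step) :
    tStep lam s0 σ st = disc lam σ (fun st' => if st' = st then 1 else 0) ([], s0) := by
  unfold tStep disc
  congr 1
  set f : G.Step → ℝ := fun st' => if st' = st then 1 else 0 with hf
  let φ : G.Hist → ℝ :=
    fun h => if h.1.head? = some st then lam ^ (h.1.length - 1) * probHist s0 σ h else 0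
  change ∑' h, φ h = _
  have hφ : ∀ h, 0 ≤ φ h := fun h => by
    simp only [φ]
    split_ifs
    · exact mul_nonneg (pow_nonneg h0 _) (probHist_nonneg _ _ _)
    · exact le_rfl
  let e := Equiv.sigmaFiberEquiv fun h : G.Hist => h.1.length
  let inst : ∀ n : ℕ, Fintype {h : G.Hist // h.1.length = n} := fun n =>
    Fintype.subtype (histN G n) fun h => mem_histN
  let g : ℕ → ℝ := fun n => ∑ h ∈ histN G n, φ h
  have hfib : ∀ n, HasSum (fun h : {h : G.Hist // h.1.length = n} => (φ ∘ e) ⟨n, h⟩) (g n) := by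
    intro n
    have := hasSum_fintype (fun h : {h : G.Hist // h.1.length = n} => φ h)
    rwa [← Finset.sum_subtype (histN G n) (fun h => mem_histN) φ] at this
  have hg0 : g 0 = 0 := by
    refine Finset.sum_eq_zero fun h hh => ?_
    rw [mem_histN, List.length_eq_zero_iff] at hh
    simp [φ, hh]
  have hg : ∀ n, g (n + 1) = lam ^ n * (step σ)^[n + 1] (lastVal f) ([], s0) := by
    intro n
    rw [← sum_probHist_mul, Finset.mul_sum]
    refine Finset.sum_congr rfl fun h hh => ?_
    obtain ⟨l, s⟩ := h
    rw [mem_histN] at hh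
    match l, hh with
    | st' :: l, hh =>
      have hl : l.length = n := by simpa using hh
      by_cases hst : st' = st
      · simp [φ, lastVal, hf, hst, hl]
      · simp [φ, lastVal, hf, hst]
  have hgs : HasSum g (∑' n : ℕ, lam ^ n * (step σ)^[n + 1] (lastVal f) ([], s0)) := by
    rw [← hasSum_nat_add_iff' 1]
    simpa [hg0, hg] using (summable_disc h0 h1 σ f ([], s0)).hasSum
  have hsum : Summable (φ ∘ e) := by
    rw [summable_sigma_of_nonneg (f := φ ∘ e) fun x => hφ _]
    refine ⟨fun n => (hfib n).summable, ?_⟩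
    simpa only [(hfib _).tsum_eq] using hgs.summable
  have := HasSum.sigma_of_hasSum hgs hfib hsum
  rw [← e.tsum_eq φ]
  exact this.tsum_eq

lemma sum_tStep_mul {lam : ℝ} (h0 : 0 ≤ lam) (h1 : lam < 1) (s0 : G.S) (σ : G.Profile)
    (f : G.Step → ℝ) : ∑ st, tStep lam s0 σ st * f st = disc lam σ f ([], s0) := by
  have h2 : f = fun st' => ∑ st, f st * (if st' = st then (1 : ℝ) else 0) := by
    ext st'; simp
  conv_rhs => rw [h2]
  rw [disc_sum h0 h1]
  refine Finset.sum_congr rfl fun st _ => ?_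
  rw [disc_const_mul, tStep_eq_disc h0 h1, mul_comm]

lemma payoffD_eq {lam : ℝ} (h0 : 0 ≤ lam) (h1 : lam < 1) (s0 : G.S) (σ : G.Profile) (i : G.I) :
    payoffD lam s0 σ i = disc lam σ (fun st => G.u i st.1 st.2) ([], s0) :=
  sum_tStep_mul h0 h1 s0 σ fun st => G.u i st.1 st.2

lemma UD_eq {lam : ℝ} (h0 : 0 ≤ lam) (h1 : lam < 1) (s0 : G.S) (σ : G.Profile) (i : G.I)
    (D : Finset G.S) :
    UD lam s0 σ i D = disc lam σ (fun st => if st.1 ∈ D then G.u i st.1 st.2 else 0)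
      ([], s0) := by
  rw [← sum_tStep_mul h0 h1]
  exact Finset.sum_congr rfl fun st _ => by split_ifs <;> simp

lemma tSet_eq {lam : ℝ} (h0 : 0 ≤ lam) (h1 : lam < 1) (s0 : G.S) (σ : G.Profile)
    (D : Finset G.S) :
    tSet lam s0 σ D = disc lam σ (fun st => if st.1 ∈ D then 1 else 0) ([], s0) := by
  rw [← sum_tStep_mul h0 h1]
  exact Finset.sum_congr rfl fun st _ => by split_ifs <;> simp

/-! ### Optimal stopping of a finite-horizon sum -/

/-- The supremum, over stopping times bounded by `b`, of the expected sum of `g` from the history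
onwards (the Snell envelope). -/
def snell (σ : G.Profile) (g : G.Step → ℝ) : ℕ → G.Hist → ℝ
  | 0 => fun _ => 0
  | b + 1 => fun h => max 0 (step σ (fun h' => lastVal g h' + snell σ g b h') h)

/-- The optimal stopping values are bounded uniformly in the horizon. -/
def SnellBdd (σ : G.Profile) (g : G.Step → ℝ) (h : G.Hist) : Prop := ∃ C, ∀ b, snell σ g b h ≤ C

lemma snell_nonneg (σ : G.Profile) (g : G.Step → ℝ) (b : ℕ) (h : G.Hist) : 0 ≤ snell σ g b h := by
  cases b with
  | zero => exact le_rfl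
  | succ b => exact le_max_left _ _

lemma partSum_le_snell (σ : G.Profile) (g : G.Step → ℝ) (b : ℕ) (h : G.Hist) :
    partSum 1 σ g b h ≤ snell σ g b h := by
  induction b generalizing h with
  | zero => exact le_rfl
  | succ b ih =>
    refine le_trans (step_le_step σ h fun a s' => ?_) (le_max_right _ _)
    rw [one_mul]
    exact add_le_add_right (ih _) _

lemma step_snell_le (σ : G.Profile) {g : G.Step → ℝ} {K : ℝ} (hg : ∀ st, -K ≤ g st) (b : ℕ)
    (h : G.Hist) : step σ (snell σ g b) h ≤ snell σ g (b + 1) h + K := by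
  have h1 : -K + step σ (snell σ g b) h ≤ step σ (fun h' => lastVal g h' + snell σ g b h') h := by
    rw [← step_const σ (-K) h, ← step_add]
    exact step_le_step σ h fun a s' => add_le_add_left (hg _) _
  have h2 : _ ≤ snell σ g (b + 1) h := le_max_right _ _
  linarith

lemma iterate_step_snell_le (σ : G.Profile) {g : G.Step → ℝ} {K : ℝ} (hg : ∀ st, -K ≤ g st)
    (n b : ℕ) (h : G.Hist) :
    (step σ)^[n] (snell σ g b) h ≤ snell σ g (n + b) h + n * K := by
  induction n generalizing h with
  | zero => simp
  | succ n ih =>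
    rw [Function.iterate_succ_apply']
    refine (step_le_step σ (F' := fun h => snell σ g (n + b) h + n * K) h fun a s' => ih _).trans ?_
    rw [step_add, step_const, Nat.add_right_comm]
    have := step_snell_le σ hg (n + b) h
    push_cast
    linarith

/-- The history has not been stopped strictly before its last stage, when stopping as soon as the
optimal stopping value with horizon `B` vanishes. -/
def alive (σ : G.Profile) (g : G.Step → ℝ) (B : ℕ) : List G.Step → Prop
  | [] => True
  | st :: l => alive σ g B l ∧ 0 < snell σ g (B - l.length) (l, st.1)

open Classical in
/-- The sum of `f` along a history up to the stopping time. -/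
def stoppedSum (σ : G.Profile) (g : G.Step → ℝ) (B : ℕ) (f : G.Step → ℝ) : List G.Step → ℝ
  | [] => 0
  | st :: l => stoppedSum σ g B f l + if alive σ g B (st :: l) then f st else 0

open Classical in
lemma snell_le_iterate_step (σ : G.Profile) (g : G.Step → ℝ) (B b : ℕ) (h : G.Hist)
    (hb : h.1.length + b = B) :
    stoppedSum σ g B g h.1 + (if alive σ g B h.1 then snell σ g b h else 0) ≤
      (step σ)^[b] (fun h => stoppedSum σ g B g h.1) h := by
  induction b generalizing h with
  | zero => simp [snell]
  | succ b ih =>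
    rw [Function.iterate_succ_apply']
    refine le_trans ?_ (step_le_step σ (F := fun h => stoppedSum σ g B g h.1 +
      if alive σ g B h.1 then snell σ g b h else 0) h fun a s' => ih (child h a s')
        (by simp only [List.length_cons]; omega))
    have hB : B - h.1.length = b + 1 := by omega
    by_cases h1 : alive σ g B h.1 ∧ 0 < snell σ g (b + 1) h
    · simp only [if_pos h1.1]
      have h2 : snell σ g (b + 1) h = step σ (fun h' => lastVal g h' + snell σ g b h') h := by
        have h3 : snell σ g (b + 1) h = max 0 _ := rfl
        rcases max_choice 0 (step σ (fun h' => lastVal g h' + snell σ g b h') h) with h4 | h4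
        · have := h1.2
          rw [h3, h4] at this
          exact absurd this (lt_irrefl _)
        · rw [h3, h4]
      rw [h2, ← step_const σ (stoppedSum σ g B g h.1) h, ← step_add]
      refine step_le_step σ h fun a s' => ?_
      simp only [stoppedSum, if_pos h1, lastVal, alive, hB]
      linarith
    · have h2 : (if alive σ g B h.1 then snell σ g (b + 1) h else 0) ≤ 0 := by
        split_ifs with h3
        · exact not_lt.1 fun h4 => h1 ⟨h3, h4⟩
        · exact le_rfl
      refine (add_le_of_nonpos_right h2).trans (const_le_step σ h fun a s' => ?_)
      simp only [stoppedSum, alive, hB, if_neg h1, add_zero, le_refl]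

lemma histOf_eq_of_le {p p' : G.Play} {n : ℕ} (h : histOf p n = histOf p' n) {m : ℕ}
    (hm : m ≤ n) : histOf p m = histOf p' m := by
  induction n with
  | zero => rwa [Nat.le_zero.1 hm]
  | succ n ih =>
    rcases hm.eq_or_lt with rfl | hm
    · exact h
    · refine ih ?_ (Nat.lt_succ_iff.1 hm)
      simp only [histOf, Prod.mk.injEq, List.cons.injEq] at h
      refine Prod.ext h.1.2 ?_
      rw [histOf_snd, histOf_snd, h.1.1]

lemma exists_not_continue (σ : G.Profile) (g : G.Step → ℝ) (B : ℕ) (p : G.Play) :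
    ∃ n, B ≤ n ∨ snell σ g (B - n) (histOf p n) ≤ 0 := ⟨B, Or.inl le_rfl⟩

open Classical in
/-- The first time the optimal stopping value with horizon `B` vanishes. -/
def stopTime (σ : G.Profile) (g : G.Step → ℝ) (B : ℕ) (p : G.Play) : ℕ :=
  Nat.find (exists_not_continue σ g B p)

lemma stopTime_le (σ : G.Profile) (g : G.Step → ℝ) (B : ℕ) (p : G.Play) : stopTime σ g B p ≤ B :=
  Nat.find_min' _ (Or.inl le_rfl)

lemma lt_stopTime_iff (σ : G.Profile) (g : G.Step → ℝ) (B : ℕ) (p : G.Play) {n : ℕ} (hn : n < B) :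
    n < stopTime σ g B p ↔ ∀ m ≤ n, 0 < snell σ g (B - m) (histOf p m) := by
  rw [stopTime, Nat.lt_find_iff]
  refine forall₂_congr fun m hm => ?_
  have : ¬ B ≤ m := by omega
  simp [this]

lemma isBddST_stopTime (σ : G.Profile) (g : G.Step → ℝ) (B : ℕ) : IsBddST (stopTime σ g B) := by
  refine ⟨⟨B, stopTime_le σ g B⟩, fun p p' n hn hp => ?_⟩
  unfold stopTime at hn ⊢
  rw [Nat.find_eq_iff] at hn ⊢
  refine ⟨by rw [← hp]; exact hn.1, fun m hm => ?_⟩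
  rw [← histOf_eq_of_le hp hm.le]
  exact hn.2 m hm

lemma alive_histOf (σ : G.Profile) (g : G.Step → ℝ) (B : ℕ) (p : G.Play) (n : ℕ) :
    alive σ g B (histOf p n).1 ↔ ∀ m < n, 0 < snell σ g (B - m) (histOf p m) := by
  induction n with
  | zero => simp [histOf, alive]
  | succ n ih =>
    have h1 : ((histOf p n).1, (p n).1) = histOf p n := by rw [← histOf_snd]
    simp only [histOf, alive, ih, length_histOf, h1, Nat.forall_lt_succ_right]

lemma stoppedSum_histOf (σ : G.Profile) (g : G.Step → ℝ) (B : ℕ) (f : G.Step → ℝ) (p : G.Play) :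
    stoppedSum σ g B f (histOf p B).1 = ∑ n ∈ Finset.range (stopTime σ g B p), f (p n) := by
  classical
  have h1 : ∀ n ≤ B, stoppedSum σ g B f (histOf p n).1 =
      ∑ k ∈ Finset.range n, if k < stopTime σ g B p then f (p k) else 0 := by
    intro n
    induction n with
    | zero => simp [histOf, stoppedSum]
    | succ n ih =>
      intro hn
      rw [Finset.sum_range_succ, ← ih (by omega)]
      have h2 : alive σ g B (p n :: (histOf p n).1) ↔ n < stopTime σ g B p := by
        rw [lt_stopTime_iff σ g B p (by omega)]
        have := alive_histOf σ g B p (n + 1)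
        simpa only [histOf, Nat.lt_succ_iff] using this
      simp only [histOf, stoppedSum, h2]
  rw [h1 B le_rfl, ← Finset.sum_filter]
  refine Finset.sum_congr ?_ fun _ _ => rfl
  ext k
  have := stopTime_le σ g B p
  simp only [Finset.mem_filter, Finset.mem_range]
  omega

lemma stoppedSum_sub (σ : G.Profile) (g : G.Step → ℝ) (B : ℕ) (w : ℝ) (f : G.Step → ℝ)
    (l : List G.Step) :
    stoppedSum σ g B (fun st => w - f st) l =
      w * stoppedSum σ g B (fun _ => 1) l + (-1) * stoppedSum σ g B f l := by
  induction l with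
  | nil => simp [stoppedSum]
  | cons st l ih => simp only [stoppedSum, ih]; split_ifs <;> ring

lemma mul_stoppedSum_le (σ : G.Profile) (g : G.Step → ℝ) (B : ℕ) {f : G.Step → ℝ} {K : ℝ}
    (hf : ∀ st, K ≤ f st) (l : List G.Step) :
    K * stoppedSum σ g B (fun _ => 1) l ≤ stoppedSum σ g B f l := by
  induction l with
  | nil => simp [stoppedSum]
  | cons st l ih =>
    simp only [stoppedSum]
    have := hf st
    split_ifs <;> linarith

/-- If the average of `f` until every long bounded stopping time is at least `w`, then the optimal
stopping values of `w - f` are bounded. -/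
lemma snellBdd_of_stopping {μfam : G.S → G.Profile → Measure G.Play} (hind : IsInduced μfam)
    (s : G.S) (σ : G.Profile) (f : G.Step → ℝ) (w N : ℝ)
    (hopt : ∀ τ : G.Play → ℕ, IsBddST τ → N ≤ ∫ p, (τ p : ℝ) ∂(μfam s σ) →
      w * ∫ p, (τ p : ℝ) ∂(μfam s σ) ≤
        ∫ p, (∑ n ∈ Finset.range (τ p), f (p n)) ∂(μfam s σ)) :
    SnellBdd σ (fun st => w - f st) ([], s) := by
  obtain ⟨K, hK, hf⟩ := exists_abs_le f
  refine ⟨max 0 ((|w| + K) * N), fun B => ?_⟩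
  set g : G.Step → ℝ := fun st => w - f st
  have hint : ∀ f' : G.Step → ℝ, ∫ p, (∑ n ∈ Finset.range (stopTime σ g B p), f' (p n)) ∂(μfam s σ)
      = (step σ)^[B] (fun h => stoppedSum σ g B f' h.1) ([], s) := fun f' => by
    rw [← integral_histOf hind]
    simp only [stoppedSum_histOf]
  have h1 := snell_le_iterate_step σ g B B ([], s) (by simp)
  rw [if_pos (show alive σ g B [] from trivial)] at h1
  simp only [stoppedSum, zero_add] at h1
  have h2 : (step σ)^[B] (fun h => stoppedSum σ g B g h.1) ([], s) =
      w * (step σ)^[B] (fun h => stoppedSum σ g B (fun _ => 1) h.1) ([], s) +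
      (-1) * (step σ)^[B] (fun h => stoppedSum σ g B f h.1) ([], s) := by
    rw [← iterate_step_const_mul, ← iterate_step_const_mul, ← iterate_step_add]
    simp only [g, stoppedSum_sub]
  have hτ : ∫ p, (stopTime σ g B p : ℝ) ∂(μfam s σ) =
      (step σ)^[B] (fun h => stoppedSum σ g B (fun _ => 1) h.1) ([], s) := by
    rw [← hint]
    simp
  have h3 := hopt (stopTime σ g B) (isBddST_stopTime σ g B)
  rw [hτ, hint f] at h3
  set t := (step σ)^[B] (fun h => stoppedSum σ g B (fun _ => 1) h.1) ([], s)
  have ht : 0 ≤ t := by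
    rw [← hτ]
    exact integral_nonneg fun p => Nat.cast_nonneg _
  have h4 : (-K) * t ≤ (step σ)^[B] (fun h => stoppedSum σ g B f h.1) ([], s) := by
    rw [← iterate_step_const_mul]
    exact iterate_step_mono σ B
      (fun h => mul_stoppedSum_le σ g B (fun st => (abs_le.1 (hf st)).1) h.1) _
  by_cases hN : N ≤ t
  · refine le_trans ?_ (le_max_left _ _)
    linarith [h3 hN]
  · refine le_trans ?_ (le_max_right _ _)
    have h5 : (w + K) * t ≤ (|w| + K) * N :=
      mul_le_mul (by linarith [le_abs_self w]) (not_le.1 hN).le ht (by positivity)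
    linarith

lemma snell_mono (σ : G.Profile) {g g' : G.Step → ℝ} (hg : ∀ st, g st ≤ g' st) (b : ℕ)
    (h : G.Hist) : snell σ g b h ≤ snell σ g' b h := by
  induction b generalizing h with
  | zero => exact le_rfl
  | succ b ih => exact max_le_max le_rfl (step_le_step σ h fun a s' => add_le_add (hg _) (ih _))

lemma SnellBdd.mono {σ : G.Profile} {g g' : G.Step → ℝ} (hg : ∀ st, g st ≤ g' st) {h : G.Hist}
    (H : SnellBdd σ g' h) : SnellBdd σ g h := by
  obtain ⟨C, hC⟩ := H
  exact ⟨C, fun b => (snell_mono σ hg b h).trans (hC b)⟩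

/-! ### Switches between elements of the partition -/

/-- A switch occurs during the last `B` stages of the history. -/
def switchedIn (r : G.S → G.S → Prop) : ℕ → List G.Step → G.S → Prop
  | 0, _, _ => False
  | _ + 1, [], _ => False
  | B + 1, st :: l, s => ¬ r st.1 s ∨ switchedIn r B l st.1

open Classical in
/-- The indicator of a switch during the last `B` stages. -/
def switchInd (r : G.S → G.S → Prop) (B : ℕ) (h : G.Hist) : ℝ :=
  if switchedIn r B h.1 h.2 then 1 else 0

/-- The probability of a switch during the `B` stages that follow a history. -/
def switchProb (σ : G.Profile) (r : G.S → G.S → Prop) (B : ℕ) (h : G.Hist) : ℝ :=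
  (step σ)^[B] (switchInd r B) h

lemma switchedIn_succ (r : G.S → G.S → Prop) (B : ℕ) (l : List G.Step) (s : G.S)
    (h : switchedIn r B l s) : switchedIn r (B + 1) l s := by
  induction B generalizing l s with
  | zero => exact h.elim
  | succ B ih =>
    cases l with
    | nil => exact h
    | cons st l => exact h.imp id (ih l st.1)

lemma switchInd_mono {r : G.S → G.S → Prop} {B B' : ℕ} {h h' : G.Hist}
    (hs : switchedIn r B h.1 h.2 → switchedIn r B' h'.1 h'.2) :
    switchInd r B h ≤ switchInd r B' h' := by
  unfold switchInd
  split_ifs with h1 h2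
  · exact le_rfl
  · exact absurd (hs h1) h2
  · exact zero_le_one
  · exact le_rfl

lemma switchInd_le_one (r : G.S → G.S → Prop) (B : ℕ) (h : G.Hist) : switchInd r B h ≤ 1 := by
  unfold switchInd
  split_ifs <;> norm_num

lemma switchInd_nonneg (r : G.S → G.S → Prop) (B : ℕ) (h : G.Hist) : 0 ≤ switchInd r B h := by
  unfold switchInd
  split_ifs <;> norm_num

lemma switchProb_nonneg (σ : G.Profile) (r : G.S → G.S → Prop) (B : ℕ) (h : G.Hist) :
    0 ≤ switchProb σ r B h := by
  have := iterate_step_mono σ B (switchInd_nonneg r B) h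
  rwa [iterate_step_const] at this

lemma switchInd_le_iterate (σ : G.Profile) (r : G.S → G.S → Prop) (k B : ℕ) (h : G.Hist) :
    switchInd r k h ≤ (step σ)^[B] (switchInd r (k + B)) h := by
  induction B generalizing k h with
  | zero => exact le_rfl
  | succ B ih =>
    rw [Function.iterate_succ_apply', ← add_assoc, Nat.add_right_comm]
    refine const_le_step σ h fun a s' => le_trans ?_ (ih (k + 1) _)
    exact switchInd_mono fun hs =>
      show switchedIn r (k + 1) (⟨h.2, a⟩ :: h.1) s' from Or.inr hs

open Classical in
lemma step_le_switchProb (σ : G.Profile) (r : G.S → G.S → Prop) (B : ℕ) (h : G.Hist) :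
    step σ (fun h' => if r h.2 h'.2 then switchProb σ r B h' else 1) h ≤
      switchProb σ r (B + 1) h := by
  rw [switchProb, Function.iterate_succ_apply']
  refine step_le_step σ h fun a s' => ?_
  split_ifs with hr
  · exact iterate_step_mono σ B (fun h => switchInd_mono fun hs => switchedIn_succ r B _ _ hs) _
  · refine le_trans (le_of_eq ?_) ((switchInd_le_iterate σ r 1 B _).trans_eq (by rw [add_comm]))
    exact (if_pos (show switchedIn r 1 (⟨h.2, a⟩ :: h.1) s' from Or.inl hr)).symm

lemma switchProb_le_one (σ : G.Profile) (r : G.S → G.S → Prop) (B : ℕ) (h : G.Hist) :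
    switchProb σ r B h ≤ 1 := by
  have := iterate_step_mono σ B (switchInd_le_one r B) h
  rwa [iterate_step_const] at this

lemma step_switchProb_le (σ : G.Profile) (r : G.S → G.S → Prop) (B : ℕ) (h : G.Hist) :
    step σ (switchProb σ r B) h ≤ switchProb σ r (B + 1) h := by
  classical
  refine (step_le_step σ h fun a s' => ?_).trans (step_le_switchProb σ r B h)
  split_ifs
  · exact le_rfl
  · exact switchProb_le_one σ r B _

section Cell

variable {r : G.S → G.S → Prop} {D : Finset G.S} {g : G.Step → ℝ} {K : ℝ}

lemma partSum_cell_le_of_notMem (σ : G.Profile) (hD : ∀ s s', r s s' → (s ∈ D ↔ s' ∈ D))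
    (hK : 0 ≤ K) (hg : ∀ st, |g st| ≤ K) (B : ℕ) (h : G.Hist) (hh : h.2 ∉ D) :
    partSum 1 σ (fun st => if st.1 ∈ D then g st else 0) B h ≤ K * B * switchProb σ r B h := by
  classical
  induction B generalizing h with
  | zero => simp [partSum]
  | succ B ih =>
    have h1 := mul_le_mul_of_nonneg_left (step_le_switchProb σ r B h)
      (by positivity : 0 ≤ K * (B + 1 : ℕ))
    refine le_trans ?_ h1
    rw [← step_const_mul]
    refine step_le_step σ h fun a s' => ?_
    simp only [lastVal, if_neg hh, zero_add, one_mul]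
    split_ifs with hr
    · refine (ih _ ((hD _ _ hr).not.1 hh)).trans ?_
      refine mul_le_mul_of_nonneg_right ?_ (switchProb_nonneg _ _ _ _)
      push_cast
      linarith
    · refine (partSum_one_le σ (K := K) (fun st => ?_) B _).trans ?_
      · split_ifs
        · exact (abs_le.1 (hg st)).2
        · exact hK
      · push_cast
        linarith

lemma partSum_cell_le (σ : G.Profile) (hD : ∀ s s', r s s' → (s ∈ D ↔ s' ∈ D))
    (hK : 0 ≤ K) (hg : ∀ st, |g st| ≤ K) (B : ℕ) (h : G.Hist) :
    partSum 1 σ (fun st => if st.1 ∈ D then g st else 0) B h ≤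
      snell σ g B h + K * B * switchProb σ r B h := by
  induction B generalizing h with
  | zero => simp [partSum, snell]
  | succ B ih =>
    by_cases hh : h.2 ∈ D
    · have h1 : step σ (fun h' => lastVal g h' + snell σ g B h') h ≤ snell σ g (B + 1) h :=
        le_max_right _ _
      have h2 : K * B * switchProb σ r B.succ h ≤ K * (B + 1 : ℕ) * switchProb σ r (B + 1) h := by
        refine mul_le_mul_of_nonneg_right ?_ (switchProb_nonneg _ _ _ _)
        push_cast
        linarith
      have h3 := mul_le_mul_of_nonneg_left (step_switchProb_le σ r B h)
        (by positivity : 0 ≤ K * B)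
      refine le_trans ?_ (add_le_add h1 (h3.trans h2))
      rw [← step_const_mul, ← step_add]
      refine step_le_step σ h fun a s' => ?_
      have := ih (child h a s')
      simp only [lastVal, if_pos hh, one_mul]
      linarith
    · have := partSum_cell_le_of_notMem σ hD hK hg (B + 1) h hh
      have := snell_nonneg σ g (B + 1) h
      linarith

lemma partSum_cell_le_of_snell (σ : G.Profile) (hD : ∀ s s', r s s' → (s ∈ D ↔ s' ∈ D))
    (hK : 0 ≤ K) (hg : ∀ st, |g st| ≤ K) (T B : ℕ) (h : G.Hist) {C δ : ℝ}
    (hC : ∀ b, snell σ g b h ≤ C) (hδ : (step σ)^[T + B] (switchInd r B) h ≤ δ) :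
    partSum 1 σ (fun st => if st.1 ∈ D then g st else 0) (T + B) h ≤
      C + 2 * K * T + K * B * δ := by
  rw [partSum_split, one_pow, one_mul]
  have h1 : partSum 1 σ (fun st => if st.1 ∈ D then g st else 0) T h ≤ T * K :=
    partSum_one_le σ (fun st => by
      split_ifs
      · exact (abs_le.1 (hg st)).2
      · exact hK) T h
  have h2 := iterate_step_mono σ T (partSum_cell_le σ hD hK hg B) h
  rw [iterate_step_add, iterate_step_const_mul] at h2
  have h3 := iterate_step_snell_le σ (fun st => (abs_le.1 (hg st)).1) T B h
  have h4 := hC (T + B)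
  rw [Function.iterate_add_apply] at hδ
  have h5 := mul_le_mul_of_nonneg_left hδ (by positivity : 0 ≤ K * B)
  have h6 : (step σ)^[T] (switchProb σ r B) h = (step σ)^[T] ((step σ)^[B] (switchInd r B)) h := rfl
  rw [h6] at h2
  linarith

end Cell

lemma switchedIn_histOf (r : G.S → G.S → Prop) (p : G.Play) (B n : ℕ)
    (h : switchedIn r B (histOf p n).1 (histOf p n).2) :
    ∃ m, n ≤ m + B ∧ ¬ r (p m).1 (p (m + 1)).1 := by
  induction B generalizing n with
  | zero => exact h.elim
  | succ B ih =>
    cases n with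
    | zero => exact h.elim
    | succ n =>
      rcases h with h | h
      · exact ⟨n, by omega, h⟩
      · rw [← histOf_snd] at h
        obtain ⟨m, hm, hr⟩ := ih n h
        exact ⟨m, by omega, hr⟩

/-- If the expected number of switches on an event of large probability is finite, then switches
after some deterministic time are unlikely. -/
lemma exists_switch_bound {μfam : G.S → G.Profile → Measure G.Play} (hind : IsInduced μfam)
    (r : G.S → G.S → Prop) (s : G.S) (σ : G.Profile) (E : Set G.Play) {ε ζ : ℝ} (hε : 0 < ε)
    (hE : ENNReal.ofReal (1 - ε) ≤ μfam s σ E)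
    (hZ : ∫⁻ p in E, Zsw r p ∂(μfam s σ) ≤ ENNReal.ofReal ζ) :
    ∃ T, ∀ B, (step σ)^[T + B] (switchInd r B) ([], s) ≤ 2 * ε := by
  classical
  have hprob := hind.1 s σ
  set μ := μfam s σ
  let A : ℕ → Set G.Play := fun n => {p | ¬ r (p n).1 (p (n + 1)).1}
  have hA : ∀ n, MeasurableSet (A n) := fun n => by
    have : Measurable fun p : G.Play => (p n, p (n + 1)) :=
      (measurable_pi_apply n).prodMk (measurable_pi_apply (n + 1))
    exact this (t := {x | ¬ r x.1.1 x.2.1}) (Set.Countable.measurableSet (Set.to_countable _))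
  have h1 : ∫⁻ p in E, Zsw r p ∂μ = ∑' n, (μ.restrict E) (A n) := by
    unfold Zsw
    rw [lintegral_tsum]
    · refine tsum_congr fun n => ?_
      rw [← lintegral_indicator_one (hA n)]
      refine lintegral_congr fun p => ?_
      by_cases hr : r (p n).1 (p (n + 1)).1 <;> simp [A, hr, Set.indicator]
    · intro n
      have : (fun p : G.Play => if r (p n).1 (p (n + 1)).1 then (0 : ℝ≥0∞) else 1) =
          (A n).indicator 1 := by
        ext p
        by_cases hr : r (p n).1 (p (n + 1)).1 <;> simp [A, hr, Set.indicator]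
      rw [this]
      exact (measurable_one.indicator (hA n)).aemeasurable
  have h2 : ∑' n, (μ.restrict E) (A n) ≠ ⊤ := by
    rw [← h1]
    exact (hZ.trans_lt ENNReal.ofReal_lt_top).ne
  have h3 := ENNReal.tendsto_sum_nat_add _ h2
  obtain ⟨T, hT⟩ := (h3.eventually (ge_mem_nhds (ENNReal.ofReal_pos.2 hε))).exists
  refine ⟨T, fun B => ?_⟩
  let W : Set G.Play := ⋃ k, A (k + T)
  have hW : MeasurableSet W := MeasurableSet.iUnion fun k => hA _
  let F := toMeasurable μ E
  have hF : MeasurableSet F := measurableSet_toMeasurable μ E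
  have h4 : μ (W ∩ F) ≤ ENNReal.ofReal ε := by
    rw [← Measure.restrict_apply hW, Measure.restrict_toMeasurable (measure_ne_top μ E)]
    exact (measure_iUnion_le _).trans hT
  have h5 : μ Fᶜ ≤ ENNReal.ofReal ε := by
    rw [prob_compl_eq_one_sub hF, tsub_le_iff_right, measure_toMeasurable]
    refine le_trans ?_ (add_le_add_right hE _)
    rw [← ENNReal.ofReal_one]
    refine le_trans (ENNReal.ofReal_le_ofReal (by linarith)) ENNReal.ofReal_add_le
  have h6 : μ W ≤ ENNReal.ofReal (2 * ε) := by
    have : W ⊆ (W ∩ F) ∪ Fᶜ := fun p hp => by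
      by_cases hpF : p ∈ F
      · exact Or.inl ⟨hp, hpF⟩
      · exact Or.inr hpF
    refine (measure_mono this).trans ((measure_union_le _ _).trans ((add_le_add h4 h5).trans ?_))
    rw [← ENNReal.ofReal_add hε.le hε.le, two_mul]
  rw [← integral_histOf hind]
  calc ∫ p, switchInd r B (histOf p (T + B)) ∂μ ≤ ∫ p, W.indicator (fun _ => (1 : ℝ)) p ∂μ := by
        refine integral_mono (integrable_histOf hind s σ (T + B) _)
          ((integrable_const (1 : ℝ)).indicator hW) fun p => ?_
        simp only [switchInd]
        split_ifs with h
        · obtain ⟨m, hm, hr⟩ := switchedIn_histOf r p B (T + B) h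
          rw [Set.indicator_of_mem]
          exact Set.mem_iUnion.2 ⟨m - T, by
            rw [Nat.sub_add_cancel (by omega)]
            exact hr⟩
        · exact Set.indicator_nonneg (fun _ _ => zero_le_one) _
    _ = μ.real W := by rw [integral_indicator_const _ hW, smul_eq_mul, mul_one]
    _ ≤ 2 * ε := ENNReal.toReal_le_of_le_ofReal (by linarith) h6

/-! ### Consequences of the partition property -/

lemma sameOf_iff {Di : Finset (Finset G.S)} (hDi : IsPartitionF Di) {D : Finset G.S} (hD : D ∈ Di)
    (s s' : G.S) (h : sameOf Di s s') : s ∈ D ↔ s' ∈ D := by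
  obtain ⟨D', hD', hs, hs'⟩ := h
  constructor
  · intro hsD
    rwa [(hDi s).unique ⟨hD, hsD⟩ ⟨hD', hs⟩]
  · intro hsD
    rwa [(hDi s').unique ⟨hD, hsD⟩ ⟨hD', hs'⟩]

lemma SubgamePerfect.snellBdd {μfam : G.S → G.Profile → Measure G.Play} (hind : IsInduced μfam)
    {vbar : G.S → ℝ} {r : G.S → G.S → Prop} {i : G.I} {σ : G.Profile} {s : G.S} {ε : ℝ}
    (H : SubgamePerfect μfam vbar r i σ s ε) :
    SnellBdd σ (fun st => vbar s - ε - G.u i st.1 st.2) ([], s) := by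
  have hprob := hind.1 s σ
  obtain ⟨N0, -, -, H⟩ := H
  refine snellBdd_of_stopping hind s σ (fun st => G.u i st.1 st.2) (vbar s - ε) N0
    fun τ hτ hN => ?_
  have h1 := (H 0 τ hτ (fun p => by simp [switchT]) ([], s) (fun p _ => by simp [switchT])).2
  have hcyl : μfam s σ (cylSet ([], s)) = 1 := by
    rw [hind.2]
    simp [probHist, probHistAux]
  have hr : (μfam s σ).restrict (cylSet ([], s)) = μfam s σ := by
    refine Measure.restrict_eq_self_of_ae_mem ?_
    rwa [← mem_ae_iff_prob_eq_one (measurableSet_cylSet _)] at hcyl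
  rw [hr, hcyl] at h1
  simp only [List.length_nil, Nat.cast_zero, sub_zero, ENNReal.toReal_one, mul_one,
    Nat.Ico_zero_eq_range] at h1
  exact h1 hN

/-- Against every strategy profile of the others, player `i` has a reply with bounded optimal
stopping values at a level close to the min-max value, whose long-run averages in every element
of the partition are almost at least that level. -/
lemma exists_reply {μfam : G.S → G.Profile → Measure G.Play} (hind : IsInduced μfam)
    {vbar : G.S → ℝ} {i : G.I} {Di : Finset (Finset G.S)} (hDi : IsPartitionF Di)
    (hP' : PropertyP' μfam vbar i Di) {ε : ℝ} (hε : 0 < ε) (s : G.S) (σ : G.Profile) :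
    ∃ σi : G.BStrat i,
      SnellBdd (Function.update σ i σi) (fun st => vbar s - ε - G.u i st.1 st.2) ([], s) ∧
      ∀ᶠ M : ℕ in atTop, ∀ D ∈ Di, partSum 1 (Function.update σ i σi)
        (fun st => if st.1 ∈ D then vbar s - ε - G.u i st.1 st.2 else 0) M ([], s) ≤ ε * M := by
  obtain ⟨ζ, -, hP'⟩ := hP'
  set K : ℝ := |vbar s| + ε + 1 with hKdef
  have hK : 0 < K := by positivity
  set ε' : ℝ := min ε (ε / (4 * K))
  have hε' : 0 < ε' := lt_min hε (by positivity)
  have hε'ε : ε' ≤ ε := min_le_left _ _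
  have hKε : K * ε' * 4 ≤ ε := by
    have := mul_le_mul_of_nonneg_left (min_le_right ε (ε / (4 * K))) (by positivity : 0 ≤ K * 4)
    rw [show K * 4 * (ε / (4 * K)) = ε by field_simp] at this
    linarith
  obtain ⟨σi, hsub, E, hE, hZ⟩ := hP' ε' hε' s σ
  have hlevel : ∀ st : G.Step, vbar s - ε - G.u i st.1 st.2 ≤ vbar s - ε' - G.u i st.1 st.2 :=
    fun st => by linarith
  have hsnell := hsub.snellBdd hind
  refine ⟨σi, hsnell.mono hlevel, ?_⟩
  obtain ⟨C, hC⟩ := hsnell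
  obtain ⟨T, hT⟩ := exists_switch_bound hind _ s _ E hε' hE hZ
  have hg : ∀ st : G.Step, |vbar s - ε' - G.u i st.1 st.2| ≤ K := fun st => by
    have h1 := abs_le.1 (G.u_bdd i st.1 st.2)
    rw [abs_le]
    constructor <;> rw [hKdef] <;> linarith [neg_abs_le (vbar s), le_abs_self (vbar s)]
  obtain ⟨M0, hM0⟩ := exists_nat_ge ((C + 2 * K * T) / (ε / 2))
  filter_upwards [eventually_ge_atTop (max M0 T)] with M hM D hD
  obtain ⟨B, rfl⟩ := Nat.exists_eq_add_of_le ((le_max_right M0 T).trans hM)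
  have h1 := partSum_cell_le_of_snell _ (sameOf_iff hDi hD) hK.le hg T B ([], s) hC (hT B)
  have h2 := partSum_mono (Function.update σ i σi)
    (f := fun st => if st.1 ∈ D then vbar s - ε - G.u i st.1 st.2 else 0)
    (f' := fun st => if st.1 ∈ D then vbar s - ε' - G.u i st.1 st.2 else 0)
    (fun st => by split_ifs; exacts [hlevel st, le_rfl]) (T + B) ([], s)
  have h3 : C + 2 * K * T ≤ (T + B : ℕ) * (ε / 2) := by
    rw [← div_le_iff₀ (by positivity)]
    exact hM0.trans (by exact_mod_cast (le_max_left M0 T).trans hM)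
  have h4 : K * B * (2 * ε') ≤ (T + B : ℕ) * (ε / 2) := by
    have h5 : (B : ℝ) * (K * ε' * 4) ≤ (T + B : ℕ) * ε := by
      refine mul_le_mul ?_ hKε (by positivity) (by positivity)
      exact_mod_cast Nat.le_add_left B T
    linarith
  linarith

/-! ### Continuation strategies -/

/-- The initial state of a history. -/
def start : List G.Step → G.S → G.S
  | [], s => s
  | st :: l, _ => start l st.1

/-- After the history `(l, s)`, the profile `σ` plays as `σ'` does from the initial state `s`. -/
def Follows (σ σ' : G.Profile) (l : List G.Step) (s : G.S) : Prop :=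
  ∀ h : G.Hist, start h.1 h.2 = s → ∀ j, σ j (h.1 ++ l, h.2) = σ' j h

lemma Follows.step_eq {σ σ' : G.Profile} {l : List G.Step} {s : G.S} (H : Follows σ σ' l s)
    {F F' : G.Hist → ℝ} {h : G.Hist} (hs : start h.1 h.2 = s)
    (hF : ∀ a s', F (⟨h.2, a⟩ :: (h.1 ++ l), s') = F' (child h a s')) :
    step σ F (h.1 ++ l, h.2) = step σ' F' h := by
  refine Finset.sum_congr rfl fun a _ => ?_
  have h1 : actProb σ (h.1 ++ l, h.2) a = actProb σ' h a :=
    Finset.prod_congr rfl fun j _ => by rw [H h hs j]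
  rw [h1]
  simp only [child, hF]

lemma Follows.snell_eq {σ σ' : G.Profile} {l : List G.Step} {s : G.S} (H : Follows σ σ' l s)
    (g : G.Step → ℝ) (b : ℕ) {h : G.Hist} (hs : start h.1 h.2 = s) :
    snell σ g b (h.1 ++ l, h.2) = snell σ' g b h := by
  induction b generalizing h with
  | zero => rfl
  | succ b ih =>
    refine congrArg (max 0) (H.step_eq hs fun a s' => ?_)
    have := ih (h := child h a s') hs
    rw [List.cons_append] at this
    rw [this]
    rfl

lemma Follows.iterate_step_eq {σ σ' : G.Profile} {l : List G.Step} {s : G.S} (H : Follows σ σ' l s)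
    (f : G.Step → ℝ) (n : ℕ) {h : G.Hist} (hs : start h.1 h.2 = s) :
    (step σ)^[n + 1] (lastVal f) (h.1 ++ l, h.2) = (step σ')^[n + 1] (lastVal f) h := by
  induction n generalizing h with
  | zero => exact H.step_eq hs fun a s' => rfl
  | succ n ih =>
    rw [Function.iterate_succ_apply' _ (n + 1), Function.iterate_succ_apply' _ (n + 1)]
    exact H.step_eq hs fun a s' => ih (h := child h a s') hs

lemma Follows.disc_eq {σ σ' : G.Profile} {l : List G.Step} {s : G.S} (H : Follows σ σ' l s)
    (lam : ℝ) (f : G.Step → ℝ) : disc lam σ f (l, s) = disc lam σ' f ([], s) := by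
  unfold disc
  congr 1
  refine tsum_congr fun n => ?_
  rw [← H.iterate_step_eq f n (h := ([], s)) rfl]
  rfl

/-- Player `i` remains in the set `R` for `n` stages almost surely, whatever the others do. -/
def Sure {i : G.I} (σi : G.BStrat i) (R : Set G.S) : ℕ → G.Hist → Prop
  | 0, h => h.2 ∈ R
  | n + 1, h => h.2 ∈ R ∧ ∀ (a : G.Prof h.2) s', 0 < (σi h).1 (a i) → 0 < G.q h.2 a s' →
      Sure σi R n (child h a s')

lemma Sure.mem {i : G.I} {σi : G.BStrat i} {R : Set G.S} {n : ℕ} {h : G.Hist}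
    (H : Sure σi R n h) : h.2 ∈ R := by
  cases n with
  | zero => exact H
  | succ n => exact H.1

lemma Sure.mono {i : G.I} {σi : G.BStrat i} {R R' : Set G.S} (hR : R ⊆ R') {n : ℕ} {h : G.Hist}
    (H : Sure σi R n h) : Sure σi R' n h := by
  induction n generalizing h with
  | zero => exact hR H
  | succ n ih => exact ⟨hR H.1, fun a s' ha hq => ih (H.2 a s' ha hq)⟩

/-- The profile that `σ` prescribes after the list of steps `l`. -/
def shift (σ : G.Profile) (l : List G.Step) : G.Profile := fun j h => σ j (h.1 ++ l, h.2)

/-- Play `σi` for `M` stages and then continue with `κ l s`, where `(l, s)` is the history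
at stage `M`. -/
def glue {i : G.I} (M : ℕ) (σi : G.BStrat i) (κ : List G.Step → G.S → G.BStrat i) : G.BStrat i :=
  fun h => if h.1.length < M then σi h else
    κ (h.1.drop (h.1.length - M)) (start (h.1.take (h.1.length - M)) h.2)
      (h.1.take (h.1.length - M), h.2)

lemma follows_glue {i : G.I} {M : ℕ} (σ : G.Profile) (σi : G.BStrat i)
    (κ : List G.Step → G.S → G.BStrat i) {l : List G.Step} (hl : l.length = M) (s : G.S) :
    Follows (Function.update σ i (glue M σi κ)) (Function.update (shift σ l) i (κ l s)) l s := by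
  intro h hs j
  rcases eq_or_ne j i with rfl | hj
  · simp only [Function.update_self, glue, List.length_append, hl]
    rw [if_neg (by omega)]
    have h1 : ∀ (l₁ l₂ : List G.Step) (s' : G.S), l₁ = h.1 → l₂ = l → s' = s →
        κ l₂ s' (l₁, h.2) = κ l s h := by
      rintro _ _ _ rfl rfl rfl
      rfl
    refine h1 _ _ _ ?_ ?_ ?_ <;> simp [← hl, hs]
  · simp only [Function.update_of_ne hj, shift]

lemma exists_glue {ι : Type*} (f : ι → G.Step → ℝ) {i : G.I} (R : Set G.S) {lam : ℝ}
    (h0 : 0 ≤ lam) (h1 : lam < 1) (σ : G.Profile) (σi : G.BStrat i) (M : ℕ) (c : ℝ) (s : G.S)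
    (hsure : Sure σi R M ([], s))
    (hcont : ∀ s ∈ R, ∀ σ : G.Profile, ∃ κi : G.BStrat i, ∀ d,
      -c ≤ disc lam (Function.update σ i κi) (f d) ([], s)) :
    ∃ κi : G.BStrat i, ∀ d,
      (1 - lam) * partSum lam (Function.update σ i σi) (f d) M ([], s) - lam ^ M * c ≤
        disc lam (Function.update σ i κi) (f d) ([], s) := by
  have h2 : ∀ (l : List G.Step) (s : G.S), ∃ κi : G.BStrat i, s ∈ R → ∀ d,
      -c ≤ disc lam (Function.update (shift σ l) i κi) (f d) ([], s) := fun l s => by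
    by_cases hs : s ∈ R
    · obtain ⟨κi, hκ⟩ := hcont s hs (shift σ l)
      exact ⟨κi, fun _ => hκ⟩
    · exact ⟨σi, fun h => absurd h hs⟩
  choose κ hκ using h2
  refine ⟨glue M σi κ, fun d => ?_⟩
  have key : ∀ (b : ℕ) (h : G.Hist), h.1.length + b = M → Sure σi R b h →
      (1 - lam) * partSum lam (Function.update σ i σi) (f d) b h - lam ^ b * c ≤
        disc lam (Function.update σ i (glue M σi κ)) (f d) h := by
    intro b
    induction b with
    | zero =>
      rintro ⟨l, s⟩ hl hs
      rw [(follows_glue σ σi κ hl s).disc_eq]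
      simpa [partSum] using hκ l s hs d
    | succ b ih =>
      intro h hl hs
      rw [disc_succ h0 h1]
      have h3 : ∀ F, step (Function.update σ i (glue M σi κ)) F h =
          step (Function.update σ i σi) F h := fun F => by
        refine Finset.sum_congr rfl fun a _ => ?_
        congr 1
        refine Finset.prod_congr rfl fun j _ => ?_
        rcases eq_or_ne j i with rfl | hj
        · simp only [Function.update_self, glue]
          rw [if_pos (by omega)]
        · simp only [Function.update_of_ne hj]
      rw [h3, partSum, ← step_const_mul, sub_eq_add_neg, ← step_const _ (-(lam ^ (b + 1) * c)) h,
        ← step_add]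
      refine step_le_step_of_supp _ i h fun a s' ha hq => ?_
      rw [Function.update_self] at ha
      have h4 := mul_le_mul_of_nonneg_left
        (ih (child h a s') (by simp only [List.length_cons]; omega) (hs.2 a s' ha hq)) h0
      rw [pow_succ]
      linarith
  exact key M ([], s) (by simp) hsure

/-! ### Compactness of the set of strategy profiles -/

instance {α : Type} [Fintype α] : CompactSpace (Mixed α) :=
  isCompact_iff_compactSpace.1 (isCompact_stdSimplex ℝ α)

lemma continuous_partSum (lam : ℝ) (i : G.I) (σi : G.BStrat i) (f : G.Step → ℝ) (n : ℕ)
    (h : G.Hist) :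
    Continuous fun σ : G.Profile => partSum lam (Function.update σ i σi) f n h := by
  induction n generalizing h with
  | zero => exact continuous_const
  | succ n ih =>
    have h1 : Continuous fun σ : G.Profile => Function.update σ i σi :=
      continuous_id.update i continuous_const
    refine continuous_finsetSum _ fun a _ => Continuous.mul ?_ (continuous_finsetSum _ fun s' _ =>
      continuous_const.mul (continuous_const.add (continuous_const.mul (ih _))))
    refine continuous_finsetProd _ fun j _ => ?_
    exact (continuous_apply (a j)).comp (continuous_subtype_val.comp
      ((continuous_apply h).comp ((continuous_apply j).comp h1)))

lemma exists_uniform_horizon {ι : Type*} [Finite ι] (f : ι → G.Step → ℝ) (i : G.I) (R : Set G.S)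
    {ε : ℝ} (hε : 0 < ε)
    (hblock : ∀ s ∈ R, ∀ σ : G.Profile, ∃ σi : G.BStrat i, ∃ M : ℕ, 1 ≤ M ∧
      Sure σi R M ([], s) ∧
      ∀ d, -(ε * M) ≤ partSum 1 (Function.update σ i σi) (f d) M ([], s)) :
    ∃ m : ℕ, ∀ s ∈ R, ∀ σ : G.Profile, ∃ σi : G.BStrat i, ∃ M : ℕ, 1 ≤ M ∧ M ≤ m ∧
      Sure σi R M ([], s) ∧
      ∀ d, -(2 * ε * M) < partSum 1 (Function.update σ i σi) (f d) M ([], s) := by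
  have h1 : ∀ s : G.S, ∃ m : ℕ, s ∈ R → ∀ σ : G.Profile, ∃ σi : G.BStrat i, ∃ M : ℕ, 1 ≤ M ∧
      M ≤ m ∧ Sure σi R M ([], s) ∧
      ∀ d, -(2 * ε * M) < partSum 1 (Function.update σ i σi) (f d) M ([], s) := by
    intro s
    by_cases hs : s ∈ R
    swap
    · exact ⟨0, fun h => absurd h hs⟩
    let V : ℕ → Set G.Profile := fun m => ⋃ (σi : G.BStrat i) (M : ℕ)
      (_ : 1 ≤ M ∧ M ≤ m ∧ Sure σi R M ([], s)), ⋂ d,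
      {σ | -(2 * ε * M) < partSum 1 (Function.update σ i σi) (f d) M ([], s)}
    have hVo : ∀ m, IsOpen (V m) := fun m => isOpen_iUnion fun σi => isOpen_iUnion fun M =>
      isOpen_iUnion fun _ => isOpen_iInter_of_finite fun d =>
        isOpen_lt continuous_const (continuous_partSum 1 i σi (f d) M _)
    have hmem : ∀ m σ, σ ∈ V m ↔ ∃ σi : G.BStrat i, ∃ M : ℕ, (1 ≤ M ∧
        M ≤ m ∧ Sure σi R M ([], s)) ∧
        ∀ d, -(2 * ε * M) < partSum 1 (Function.update σ i σi) (f d) M ([], s) := fun m σ => by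
      simp only [V, Set.mem_iUnion, Set.mem_iInter, Set.mem_ofPred_eq, exists_prop]
    have hVmono : Monotone V := fun m m' hm σ hσ => by
      rw [hmem] at hσ ⊢
      obtain ⟨σi, M, ⟨h1, h2, h3⟩, h4⟩ := hσ
      exact ⟨σi, M, ⟨h1, h2.trans hm, h3⟩, h4⟩
    obtain ⟨m, hm⟩ := isCompact_univ.elim_directed_cover V hVo (fun σ _ => by
      obtain ⟨σi, M, hM, hsure, hd⟩ := hblock s hs σ
      refine Set.mem_iUnion.2 ⟨M, (hmem M σ).2 ⟨σi, M, ⟨hM, le_rfl, hsure⟩, fun d => ?_⟩⟩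
      have : 0 < ε * M := mul_pos hε (by exact_mod_cast hM)
      linarith [hd d]) hVmono.directed_le
    refine ⟨m, fun _ σ => ?_⟩
    obtain ⟨σi, M, ⟨h1, h2, h3⟩, h4⟩ := (hmem m σ).1 (hm (Set.mem_univ σ))
    exact ⟨σi, M, h1, h2, h3, h4⟩
  choose m hm using h1
  refine ⟨∑ s, m s, fun s hs σ => ?_⟩
  obtain ⟨σi, M, h1, h2, h3⟩ := hm s hs σ
  exact ⟨σi, M, h1, h2.trans (Finset.single_le_sum (fun _ _ => Nat.zero_le _)
    (Finset.mem_univ s)), h3⟩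

lemma partSum_one_le_partSum {lam : ℝ} (h0 : 0 ≤ lam) (h1 : lam ≤ 1) (σ : G.Profile)
    {f : G.Step → ℝ} {K : ℝ} (hf : ∀ st, f st ≤ K) (hK : 0 ≤ K) (n : ℕ) (h : G.Hist) :
    partSum 1 σ f n h - (1 - lam) * K * n ^ 2 ≤ partSum lam σ f n h := by
  induction n generalizing h with
  | zero => simp [partSum]
  | succ n ih =>
    rw [partSum, partSum, sub_eq_add_neg, ← step_const σ (-((1 - lam) * K * (n + 1 : ℕ) ^ 2)) h,
      ← step_add]
    refine step_le_step σ h fun a s' => ?_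
    have h2 := mul_le_mul_of_nonneg_left (ih (child h a s')) h0
    have h3 := mul_le_mul_of_nonneg_left (partSum_one_le σ hf n (child h a s')) (sub_nonneg.2 h1)
    have h4 : 0 ≤ (1 - lam) * K := mul_nonneg (sub_nonneg.2 h1) hK
    have h5 : 0 ≤ (1 - lam) * K * n ^ 2 * (1 - lam) :=
      mul_nonneg (mul_nonneg h4 (sq_nonneg _)) (sub_nonneg.2 h1)
    have h6 : 0 ≤ (1 - lam) * K * (n + 1) := mul_nonneg h4 (by positivity)
    push_cast
    nlinarith

lemma disc_block_bound {lam : ℝ} (h0 : 0 ≤ lam) (h1 : lam ≤ 1) {m M : ℕ} (hMm : M ≤ m)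
    (hm : 1 / 2 ≤ lam ^ m) : (1 - lam) * M ≤ 2 * (1 - lam ^ M) := by
  have h2 : ∀ k ≤ m, (1 - lam) * k ≤ 2 * (1 - lam ^ k) := by
    intro k
    induction k with
    | zero => intro _; simp
    | succ k ih =>
      intro hk
      have h3 := ih (by omega)
      have h4 : 1 / 2 ≤ lam ^ k := hm.trans (pow_le_pow_of_le_one h0 h1 (by omega))
      have h5 := mul_le_mul_of_nonneg_left h4 (sub_nonneg.2 h1)
      rw [pow_succ]
      push_cast
      linarith
  exact h2 M hMm

/-- If from every state of `R` player `i` can guarantee, over some block of stages during which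
the play remains in `R`, that the average of every `f d` is almost nonnegative, then he can
guarantee that all the discounted averages are almost nonnegative. -/
lemma eventually_disc_ge {ι : Type*} [Finite ι] (f : ι → G.Step → ℝ) (i : G.I) (R : Set G.S)
    (hblock : ∀ ε > 0, ∀ s ∈ R, ∀ σ : G.Profile, ∃ σi : G.BStrat i, ∃ M : ℕ, 1 ≤ M ∧
      Sure σi R M ([], s) ∧
      ∀ d, -(ε * M) ≤ partSum 1 (Function.update σ i σi) (f d) M ([], s))
    {ε : ℝ} (hε : 0 < ε) :
    ∀ᶠ lam : ℝ in 𝓝[<] 1, ∀ s ∈ R, ∀ σ : G.Profile, ∃ σi : G.BStrat i, ∀ d,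
      -ε ≤ disc lam (Function.update σ i σi) (f d) ([], s) := by
  cases nonempty_fintype ι
  obtain ⟨K, hK, hfK⟩ : ∃ K : ℝ, 0 ≤ K ∧ ∀ d st, |f d st| ≤ K := by
    choose K hK hfK using fun d => exists_abs_le (f d)
    exact ⟨∑ d, K d, Finset.sum_nonneg fun d _ => hK d, fun d st =>
      (hfK d st).trans (Finset.single_le_sum (fun d _ => hK d) (Finset.mem_univ d))⟩
  obtain ⟨m, hm⟩ := exists_uniform_horizon f i R (by positivity : 0 < ε / 8)
    (hblock (ε / 8) (by positivity))
  have hlim : ∀ᶠ lam : ℝ in 𝓝[<] 1, 1 / 2 < lam ^ m ∧ (1 - lam) * K * m < ε / 8 := by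
    refine (nhdsWithin_le_nhds : 𝓝[<] (1 : ℝ) ≤ 𝓝 1) (Filter.Eventually.and ?_ ?_)
    · have : Continuous fun lam : ℝ => lam ^ m := by fun_prop
      exact this.continuousAt.eventually (lt_mem_nhds (by norm_num))
    · have : Continuous fun lam : ℝ => (1 - lam) * K * m := by fun_prop
      exact this.continuousAt.eventually (gt_mem_nhds (by simpa using by positivity))
  filter_upwards [hlim, Ioo_mem_nhdsLT (zero_lt_one : (0 : ℝ) < 1)] with lam hlam hlam01
  obtain ⟨h0, h1⟩ := hlam01
  have hind : ∀ k : ℕ, ∀ s ∈ R, ∀ σ : G.Profile, ∃ σi : G.BStrat i, ∀ d,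
      -(3 / 4 * ε + lam ^ k * K) ≤ disc lam (Function.update σ i σi) (f d) ([], s) := by
    intro k
    induction k with
    | zero =>
      intro s _ σ
      refine ⟨σ i, fun d => ?_⟩
      have h2 := disc_mono h0.le h1 (Function.update σ i (σ i)) (f := fun _ => -K) (f' := f d)
        (fun st => (abs_le.1 (hfK d st)).1) ([], s)
      rw [disc_const h0.le h1] at h2
      rw [pow_zero]
      linarith
    | succ k ih =>
      intro s hs σ
      obtain ⟨σi, M, hM1, hMm, hsure, hd⟩ := hm s hs σ
      obtain ⟨κi, hκ⟩ := exists_glue f R h0.le h1 σ σi M _ s hsure ih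
      refine ⟨κi, fun d => le_trans ?_ (hκ d)⟩
      have h2 := partSum_one_le_partSum h0.le h1.le (Function.update σ i σi)
        (fun st => (abs_le.1 (hfK d st)).2) hK M ([], s)
      have h3 := disc_block_bound h0.le h1.le hMm hlam.1.le
      have h4 : (1 - lam) * K * M ^ 2 ≤ ε / 8 * M := by
        have h5 : (1 - lam) * K * M ≤ ε / 8 := by
          refine le_trans ?_ hlam.2.le
          refine mul_le_mul_of_nonneg_left (by exact_mod_cast hMm)
            (mul_nonneg (by linarith) hK)
        have := mul_le_mul_of_nonneg_right h5 (Nat.cast_nonneg M : (0 : ℝ) ≤ M)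
        linarith
      have h5 : (1 - lam) * (-(3 / 8 * ε * M)) ≤
          (1 - lam) * partSum lam (Function.update σ i σi) (f d) M ([], s) :=
        mul_le_mul_of_nonneg_left (by linarith [hd d]) (by linarith)
      have h6 := mul_le_mul_of_nonneg_left h3 (by positivity : 0 ≤ 3 / 8 * ε)
      have h7 : lam ^ M * (lam ^ k * K) ≤ lam ^ (k + 1) * K := by
        rw [← mul_assoc, ← pow_add]
        exact mul_le_mul_of_nonneg_right (pow_le_pow_of_le_one h0.le h1.le (by omega)) hK
      linarith
  obtain ⟨k, hk⟩ := exists_pow_lt_of_lt_one (by positivity : 0 < ε / (4 * (K + 1))) h1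
  intro s hs σ
  obtain ⟨σi, hσi⟩ := hind k s hs σ
  refine ⟨σi, fun d => le_trans ?_ (hσi d)⟩
  rw [lt_div_iff₀ (by positivity)] at hk
  have : 0 ≤ lam ^ k := pow_nonneg h0.le k
  linarith

/-! ### Trembling and punishing -/

/-- The set of states from which player `i` has, against any strategy profile of the others,
a reply whose optimal stopping values are bounded. -/
def goodSet (i : G.I) (g : G.Step → ℝ) : Set G.S :=
  {s | ∀ σ : G.Profile, ∃ σi : G.BStrat i, SnellBdd (Function.update σ i σi) g ([], s)}

/-- Mix the uniform distribution into a mixed action with weight `η`. -/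
def tremble {α : Type} [Fintype α] [Nonempty α] (η : ℝ) (h0 : 0 ≤ η) (h1 : η ≤ 1)
    (x : Mixed α) : Mixed α :=
  ⟨fun a => (1 - η) * x.1 a + η * (Fintype.card α : ℝ)⁻¹,
    fun a => add_nonneg (mul_nonneg (by linarith) (x.2.1 a)) (by positivity), by
      rw [Finset.sum_add_distrib, ← Finset.mul_sum, x.2.2]
      simp only [Finset.sum_const, Finset.card_univ, nsmul_eq_mul]
      field_simp
      ring⟩

lemma tremble_pos {α : Type} [Fintype α] [Nonempty α] {η : ℝ} (h0 : 0 < η) (h1 : η ≤ 1)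
    (x : Mixed α) (a : α) : 0 < (tremble η h0.le h1 x).1 a :=
  add_pos_of_nonneg_of_pos (mul_nonneg (by linarith) (x.2.1 a)) (by positivity)

lemma mul_le_tremble {α : Type} [Fintype α] [Nonempty α] {η : ℝ} (h0 : 0 ≤ η) (h1 : η ≤ 1)
    (x : Mixed α) (a : α) : (1 - η) * x.1 a ≤ (tremble η h0 h1 x).1 a :=
  le_add_of_nonneg_right (by positivity)

open Classical in
/-- If the play has left `R`, the steps since the first time this happened together with the
state at that time. -/
def exitOf (R : Set G.S) : List G.Step → G.S → Option (List G.Step × G.S)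
  | [], s => if s ∈ R then none else some ([], s)
  | st :: l, s => (exitOf R l st.1).elim (if s ∈ R then none else some ([], s))
      fun x => some (st :: x.1, x.2)

lemma mem_of_exitOf_eq_none {R : Set G.S} {l : List G.Step} {s : G.S}
    (h : exitOf R l s = none) : s ∈ R := by
  by_contra hs
  cases l with
  | nil => simp [exitOf, hs] at h
  | cons st l =>
    rw [exitOf] at h
    cases hl : exitOf R l st.1 <;> simp [hl, hs] at h

lemma exitOf_append {R : Set G.S} {l : List G.Step} {s : G.S} (hl : exitOf R l s = some ([], s))
    (l' : List G.Step) (s' : G.S) (hs : start l' s' = s) :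
    exitOf R (l' ++ l) s' = some (l', s) := by
  induction l' generalizing s' with
  | nil =>
    have : s' = s := hs
    rw [this]
    exact hl
  | cons st l' ih => simp [exitOf, ih st.1 hs]

/-- The weight of the trembles after a history of length `m`. -/
def trembleWeight (G : StocGame) (η : ℝ) (m : ℕ) : ℝ :=
  η / 2 ^ (m + 1) / (Fintype.card G.I + 1)

lemma trembleWeight_pos {η : ℝ} (h0 : 0 < η) (m : ℕ) : 0 < trembleWeight G η m := by
  unfold trembleWeight
  positivity

lemma trembleWeight_le {η : ℝ} (h0 : 0 < η) (m : ℕ) :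
    Fintype.card G.I * trembleWeight G η m ≤ η / 2 ^ (m + 1) := by
  unfold trembleWeight
  rw [mul_div_assoc', div_le_iff₀ (by positivity)]
  have : 0 < η / 2 ^ (m + 1) := by positivity
  linarith

lemma trembleWeight_le_one {η : ℝ} (h1 : η ≤ 1) (m : ℕ) :
    trembleWeight G η m ≤ 1 := by
  unfold trembleWeight
  rw [div_div]
  refine div_le_one_of_le₀ (h1.trans ?_) (by positivity)
  have h2 : (1 : ℝ) ≤ 2 ^ (m + 1) := one_le_pow₀ one_le_two
  have h3 : (0 : ℝ) ≤ Fintype.card G.I := Nat.cast_nonneg _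
  nlinarith

/-- Follow a trembled version of `σ` as long as the play remains in `R`; once the play exits `R`
at a state `s`, switch to the profile `bad s`. -/
def punish (R : Set G.S) {η : ℝ} (h0 : 0 < η) (h1 : η ≤ 1) (bad : G.S → G.Profile)
    (σ : G.Profile) : G.Profile := fun j h =>
  (exitOf R h.1 h.2).elim
    (tremble (trembleWeight G η h.1.length) (trembleWeight_pos h0 _).le
      (trembleWeight_le_one h1 _) (σ j h))
    fun x => bad x.2 j (x.1, h.2)

section Punish

variable {R : Set G.S} {η : ℝ} (h0 : 0 < η) (h1 : η ≤ 1) {bad : G.S → G.Profile}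
  (σ : G.Profile) {i : G.I} (σi : G.BStrat i)

lemma punish_eq_of_none {h : G.Hist} (hh : exitOf R h.1 h.2 = none) (j : G.I) :
    punish R h0 h1 bad σ j h = tremble (trembleWeight G η h.1.length)
      (trembleWeight_pos h0 _).le (trembleWeight_le_one h1 _) (σ j h) := by
  rw [punish, hh]
  rfl

lemma exitOf_child {h : G.Hist} (hh : exitOf R h.1 h.2 = none) (a : G.Prof h.2) {s' : G.S}
    (hs' : s' ∈ R) : exitOf R (child h a s').1 (child h a s').2 = none := by
  simp [exitOf, hh, hs']

lemma follows_punish {l : List G.Step} {s : G.S} (hl : exitOf R l s = some ([], s)) :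
    Follows (Function.update (punish R h0 h1 bad σ) i σi)
      (Function.update (bad s) i fun h => σi (h.1 ++ l, h.2)) l s := by
  intro h hs j
  rcases eq_or_ne j i with rfl | hj
  · simp only [Function.update_self]
  · simp only [Function.update_of_ne hj, punish, exitOf_append hl h.1 h.2 hs]
    rfl

lemma sure_of_snellBdd {g : G.Step → ℝ}
    (hbad : ∀ s ∉ R, ∀ κ : G.BStrat i, ¬ SnellBdd (Function.update (bad s) i κ) g ([], s))
    (n : ℕ) (h : G.Hist) (hh : exitOf R h.1 h.2 = none)
    (hsn : SnellBdd (Function.update (punish R h0 h1 bad σ) i σi) g h) : Sure σi R n h := by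
  induction n generalizing h with
  | zero => exact mem_of_exitOf_eq_none hh
  | succ n ih =>
    refine ⟨mem_of_exitOf_eq_none hh, fun a s' ha hq => ?_⟩
    set τ := Function.update (punish R h0 h1 bad σ) i σi
    have hchild : SnellBdd τ g (child h a s') := by
      obtain ⟨C, hC⟩ := hsn
      obtain ⟨K, hK, hg⟩ := exists_abs_le g
      have hpos : 0 < actProb τ h a * G.q h.2 a s' := by
        refine mul_pos (Finset.prod_pos fun j _ => ?_) hq
        rcases eq_or_ne j i with rfl | hj
        · simpa only [τ, Function.update_self] using ha
        · simp only [τ, Function.update_of_ne hj, punish_eq_of_none h0 h1 σ hh]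
          exact tremble_pos (trembleWeight_pos h0 _) _ _ _
      refine ⟨(C + K) / (actProb τ h a * G.q h.2 a s'), fun b => ?_⟩
      rw [le_div_iff₀ hpos, mul_comm]
      have h2 := mul_le_step_of_nonneg τ (F := snell τ g b) h (fun _ _ => snell_nonneg _ _ _ _) a s'
      have h3 := step_snell_le τ (fun st => (abs_le.1 (hg st)).1) b h
      linarith [hC (b + 1)]
    by_cases hs' : s' ∈ R
    · exact ih _ (exitOf_child hh a hs') hchild
    · refine absurd ?_ (hbad s' hs' fun h' => σi (h'.1 ++ (⟨h.2, a⟩ :: h.1), h'.2))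
      have hl : exitOf R (⟨h.2, a⟩ :: h.1) s' = some ([], s') := by simp [exitOf, hh, hs']
      obtain ⟨C, hC⟩ := hchild
      refine ⟨C, fun b => ?_⟩
      rw [← (follows_punish h0 h1 σ σi hl).snell_eq g b (h := ([], s')) rfl]
      exact hC b

lemma mul_actProb_le {h : G.Hist} (hh : exitOf R h.1 h.2 = none) (a : G.Prof h.2) :
    (1 - η / 2 ^ (h.1.length + 1)) * actProb (Function.update σ i σi) h a ≤
      actProb (Function.update (punish R h0 h1 bad σ) i σi) h a := by
  have hw0 := trembleWeight_pos (G := G) h0 h.1.length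
  have hw1 := trembleWeight_le_one (G := G) h1 h.1.length
  have hw2 := trembleWeight_le (G := G) h0 h.1.length
  set w := trembleWeight G η h.1.length with hw
  have h2 : 1 - η / 2 ^ (h.1.length + 1) ≤ (1 - w) ^ Fintype.card G.I := by
    have := one_add_mul_le_pow (a := -w) (by linarith) (Fintype.card G.I)
    rw [sub_eq_add_neg 1 w]
    linarith
  refine (mul_le_mul_of_nonneg_right h2 (actProb_nonneg _ _ _)).trans ?_
  rw [actProb, ← Finset.card_univ, ← Finset.prod_const, ← Finset.prod_mul_distrib]
  refine Finset.prod_le_prod (fun j _ => mul_nonneg (by linarith)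
    ((Function.update σ i σi j h).2.1 _)) fun j _ => ?_
  rcases eq_or_ne j i with rfl | hj
  · simp only [Function.update_self]
    have := (σi h).2.1 (a j)
    nlinarith
  · simp only [Function.update_of_ne hj, punish_eq_of_none h0 h1 σ hh]
    exact mul_le_tremble _ _ _ _

lemma mul_partSum_le {f : G.Step → ℝ} (hf : ∀ st, 0 ≤ f st) (n : ℕ) (h : G.Hist)
    (hh : exitOf R h.1 h.2 = none) (hsure : Sure σi R n h) :
    (1 - η / 2 ^ h.1.length) * partSum 1 (Function.update σ i σi) f n h ≤
      partSum 1 (Function.update (punish R h0 h1 bad σ) i σi) f n h := by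
  have hnn : ∀ (τ : G.Profile) n h, 0 ≤ partSum 1 τ f n h := fun τ n h => by
    have := partSum_mono τ (f := fun _ => 0) hf n h
    rwa [partSum_one_const, mul_zero] at this
  induction n generalizing h with
  | zero => simp [partSum]
  | succ n ih =>
    set τ := Function.update σ i σi with hτ
    set τ' := Function.update (punish R h0 h1 bad σ) i σi
    set θ := 1 - η / 2 ^ (h.1.length + 1) with hθdef
    have hη : η / 2 ^ (h.1.length + 1) ≤ 1 :=
      div_le_one_of_le₀ (h1.trans (one_le_pow₀ one_le_two)) (by positivity)
    have hη0 : 0 < η / 2 ^ (h.1.length + 1) := by positivity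
    have hθ : 0 ≤ θ := by linarith
    have hθ1 : θ ≤ 1 := by linarith
    have hθθ : 1 - η / 2 ^ h.1.length ≤ θ * θ := by
      have : η / 2 ^ h.1.length = 2 * (η / 2 ^ (h.1.length + 1)) := by
        rw [pow_succ]; field_simp
      rw [this, hθdef]
      nlinarith [sq_nonneg (η / 2 ^ (h.1.length + 1))]
    refine (mul_le_mul_of_nonneg_right hθθ (hnn _ _ _)).trans ?_
    have h3 : ∀ (F : G.Hist → ℝ), (∀ a s', 0 ≤ F (child h a s')) →
        θ * step τ F h ≤ step τ' F h := fun F hF => by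
      rw [step, Finset.mul_sum]
      refine Finset.sum_le_sum fun a _ => ?_
      rw [← mul_assoc]
      exact mul_le_mul_of_nonneg_right (mul_actProb_le h0 h1 σ σi hh a)
        (Finset.sum_nonneg fun s' _ => mul_nonneg (G.q_nonneg _ _ _) (hF a s'))
    have h4 : θ * partSum 1 τ f (n + 1) h ≤
        step τ (fun h' => lastVal f h' + 1 * partSum 1 τ' f n h') h := by
      rw [partSum, ← step_const_mul]
      refine step_le_step_of_supp τ i h fun a s' ha hq => ?_
      rw [hτ, Function.update_self] at ha
      have hs := hsure.2 a s' ha hq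
      have h5 := ih (child h a s') (exitOf_child hh a hs.mem) hs
      simp only [List.length_cons] at h5
      have h6 : 0 ≤ lastVal f (child h a s') := hf _
      nlinarith
    rw [mul_assoc]
    refine (mul_le_mul_of_nonneg_left h4 hθ).trans (h3 _ fun a s' => ?_)
    rw [one_mul]
    exact add_nonneg (hf _) (hnn _ _ _)

end Punish

/-- Every strategy profile can be perturbed in such a way that replies to the perturbation with
bounded optimal stopping values keep the play in the good set, and perform against the original
profile almost as they do against the perturbation. -/
lemma exists_perturbation (i : G.I) (g : G.Step → ℝ) (σ : G.Profile) {η : ℝ} (h0 : 0 < η)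
    (h1 : η ≤ 1) :
    ∃ σ' : G.Profile, ∀ s ∈ goodSet i g, ∀ σi : G.BStrat i,
      SnellBdd (Function.update σ' i σi) g ([], s) →
        (∀ n, Sure σi (goodSet i g) n ([], s)) ∧
        ∀ (f : G.Step → ℝ) (K : ℝ), (∀ st, |f st| ≤ K) → ∀ n : ℕ,
          partSum 1 (Function.update σ' i σi) f n ([], s) - 2 * η * K * n ≤
            partSum 1 (Function.update σ i σi) f n ([], s) := by
  have h2 : ∀ s, ∃ τ : G.Profile, s ∉ goodSet i g →
      ∀ κ : G.BStrat i, ¬ SnellBdd (Function.update τ i κ) g ([], s) := fun s => by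
    by_cases hs : s ∈ goodSet i g
    · exact ⟨σ, fun h => absurd hs h⟩
    · simp only [goodSet, Set.mem_ofPred_eq, not_forall, not_exists] at hs
      obtain ⟨τ, hτ⟩ := hs
      exact ⟨τ, fun _ => hτ⟩
  choose bad hbad using h2
  refine ⟨punish (goodSet i g) h0 h1 bad σ, fun s hs σi hsn => ?_⟩
  have hex : exitOf (goodSet i g) [] s = none := by simp [exitOf, hs]
  have hsure := fun n => sure_of_snellBdd h0 h1 σ σi hbad n ([], s) hex hsn
  refine ⟨hsure, fun f K hf n => ?_⟩
  have h3 := mul_partSum_le (bad := bad) h0 h1 σ σi (f := fun st => K + (-1) * f st)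
    (fun st => by linarith [(abs_le.1 (hf st)).2]) n ([], s) hex (hsure n)
  rw [partSum_add, partSum_add, partSum_const_mul, partSum_const_mul, partSum_one_const,
    partSum_one_const] at h3
  simp only [List.length_nil, pow_zero, div_one] at h3
  have h4 := partSum_mono (Function.update σ i σi) (f := fun _ => -K) (f' := f)
    (fun st => (abs_le.1 (hf st)).1) n ([], s)
  rw [partSum_one_const] at h4
  nlinarith

/-! ### The min-max values -/

instance : Nonempty G.Profile :=
  ⟨fun j h => ⟨fun _ => (Fintype.card (G.A j h.2) : ℝ)⁻¹, fun _ => by positivity, by simp⟩⟩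

lemma partSum_nonneg_of_sure {i : G.I} {σi : G.BStrat i} {R : Set G.S} (σ : G.Profile)
    {f : G.Step → ℝ} (hf : ∀ st : G.Step, st.1 ∈ R → 0 ≤ f st) {n : ℕ} {h : G.Hist}
    (hs : Sure σi R n h) : 0 ≤ partSum 1 (Function.update σ i σi) f n h := by
  induction n generalizing h with
  | zero => exact le_rfl
  | succ n ih =>
    rw [partSum]
    refine (step_const (Function.update σ i σi) 0 h).ge.trans
      (step_le_step_of_supp _ i h fun a s' ha hq => ?_)
    rw [Function.update_self] at ha
    rw [one_mul]
    exact add_nonneg (hf _ hs.1) (ih (hs.2 a s' ha hq))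

lemma abs_payoffD_le {lam : ℝ} (h0 : 0 ≤ lam) (h1 : lam < 1) (s : G.S) (σ : G.Profile) (i : G.I) :
    |payoffD lam s σ i| ≤ 1 := by
  rw [payoffD_eq h0 h1, abs_le]
  constructor
  · rw [← disc_const h0 h1 σ (-1) ([], s)]
    exact disc_mono h0 h1 σ (fun st => (abs_le.1 (G.u_bdd i st.1 st.2)).1) _
  · rw [← disc_const h0 h1 σ 1 ([], s)]
    exact disc_mono h0 h1 σ (fun st => (abs_le.1 (G.u_bdd i st.1 st.2)).2) _

lemma bddAbove_payoffD {lam : ℝ} (h0 : 0 ≤ lam) (h1 : lam < 1) (s : G.S) (σ : G.Profile)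
    (i : G.I) :
    BddAbove (Set.range fun σi : G.BStrat i => payoffD lam s (Function.update σ i σi) i) :=
  ⟨1, by rintro _ ⟨σi, rfl⟩; exact (abs_le.1 (abs_payoffD_le h0 h1 s _ i)).2⟩

/-- The uniform min-max value is at least `w` at every state from which player `i` has bounded
optimal stopping values at level `w`. -/
lemma le_of_mem_goodSet {i : G.I} {vbar : G.S → ℝ}
    (hv : ∀ s, Tendsto (fun lam => minmaxOrig G lam s i) (𝓝[<] (1 : ℝ)) (𝓝 (vbar s)))
    {w : ℝ} {s : G.S} (hs : s ∈ goodSet i fun st => w - G.u i st.1 st.2) : w ≤ vbar s := by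
  set g : G.Step → ℝ := fun st => w - G.u i st.1 st.2 with hg
  have hblock : ∀ ε > 0, ∀ s ∈ goodSet i g, ∀ σ : G.Profile, ∃ σi : G.BStrat i, ∃ M : ℕ,
      1 ≤ M ∧ Sure σi (goodSet i g) M ([], s) ∧
      ∀ _ : Unit, -(ε * M) ≤
        partSum 1 (Function.update σ i σi) (fun st => (-1) * g st) M ([], s) := by
    intro ε hε s hs σ
    obtain ⟨K, hK, hgK⟩ := exists_abs_le fun st => (-1) * g st
    obtain ⟨σ', hσ'⟩ := exists_perturbation i g σ
      (lt_min zero_lt_one (by positivity) : 0 < min 1 (ε / (4 * (K + 1)))) (min_le_left _ _)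
    obtain ⟨σi, hσi⟩ := hs σ'
    obtain ⟨hsure, hpert⟩ := hσ' s hs σi hσi
    obtain ⟨C, hC⟩ := hσi
    obtain ⟨M, hM⟩ := exists_nat_ge (max 1 (2 * C / ε))
    refine ⟨σi, M, by exact_mod_cast (le_max_left _ _).trans hM, hsure M, fun _ => ?_⟩
    have h1 := hpert _ K hgK M
    rw [partSum_const_mul] at h1
    have h2 := (partSum_le_snell (Function.update σ' i σi) g M ([], s)).trans (hC M)
    have h3 := (le_max_right _ _).trans hM
    rw [div_le_iff₀ hε] at h3
    have h4 : 2 * min 1 (ε / (4 * (K + 1))) * K ≤ ε / 2 := by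
      have h5 : min 1 (ε / (4 * (K + 1))) * (K + 1) ≤ ε / 4 := by
        refine (mul_le_mul_of_nonneg_right (min_le_right _ _) (by positivity)).trans_eq ?_
        field_simp
      have h6 : 0 < min 1 (ε / (4 * (K + 1))) := lt_min zero_lt_one (by positivity)
      linarith
    have h5 := mul_le_mul_of_nonneg_right h4 (Nat.cast_nonneg M : (0 : ℝ) ≤ M)
    linarith
  refine le_of_forall_pos_le_add fun ε hε => ?_
  rw [← sub_le_iff_le_add]
  refine ge_of_tendsto (hv s) ?_
  filter_upwards [eventually_disc_ge (fun (_ : Unit) st => (-1) * g st) i _ hblock hε,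
    Ioo_mem_nhdsLT (zero_lt_one : (0 : ℝ) < 1)] with lam hlam ⟨h0, h1⟩
  refine le_ciInf fun σ => ?_
  obtain ⟨σi, hσi⟩ := hlam s hs σ
  refine le_ciSup_of_le (bddAbove_payoffD h0.le h1 s σ i) σi ?_
  have h2 := hσi ()
  have h3 : (fun st => (-1) * g st) = fun st : G.Step => G.u i st.1 st.2 + (-w) := by
    ext st
    simp only [hg]
    ring
  rw [h3, disc_add h0.le h1, disc_const h0.le h1, ← payoffD_eq h0.le h1] at h2
  linarith

open Classical in
/-- The payoff of player `i` in `D` relative to the level `w`, if `D` contains a state with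
min-max value at least `w`; a penalty for visiting `D`, otherwise. -/
def excess (vbar : G.S → ℝ) (i : G.I) (w : ℝ) (D : Finset G.S) (st : G.Step) : ℝ :=
  if ∃ s ∈ D, w ≤ vbar s then if st.1 ∈ D then G.u i st.1 st.2 - w else 0
  else if st.1 ∈ D then -1 else 0

lemma exists_gap (vbar : G.S → ℝ) (s : G.S) {ε : ℝ} (hε : 0 < ε) :
    ∃ δ, 0 < δ ∧ δ < ε ∧ ∀ s', vbar s - δ ≤ vbar s' → vbar s ≤ vbar s' := by
  have h1 : ∀ᶠ δ in 𝓝[>] (0 : ℝ), ∀ s', vbar s - δ ≤ vbar s' → vbar s ≤ vbar s' := by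
    refine Filter.eventually_all.2 fun s' => ?_
    rcases le_or_gt (vbar s) (vbar s') with h | h
    · exact Eventually.of_forall fun _ _ => h
    · filter_upwards [Ioo_mem_nhdsGT (sub_pos.2 h)] with δ hδ hle
      linarith [hδ.2]
  obtain ⟨δ, hδ, hδ'⟩ := (h1.and (Ioo_mem_nhdsGT hε)).exists
  exact ⟨δ, hδ'.1, hδ'.2, hδ⟩

lemma exists_excess_block {μfam : G.S → G.Profile → Measure G.Play} (hind : IsInduced μfam)
    {i : G.I} {vbar : G.S → ℝ}
    (hv : ∀ s, Tendsto (fun lam => minmaxOrig G lam s i) (𝓝[<] (1 : ℝ)) (𝓝 (vbar s)))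
    {Di : Finset (Finset G.S)} (hDi : IsPartitionF Di) (hP' : PropertyP' μfam vbar i Di)
    {w ε : ℝ} (hε : 0 < ε) {s : G.S} (hs : w ≤ vbar s) (σ : G.Profile) :
    ∃ σi : G.BStrat i, ∃ M : ℕ, 1 ≤ M ∧ Sure σi {s | w ≤ vbar s} M ([], s) ∧
      ∀ D : Di, -(ε * M) ≤ partSum 1 (Function.update σ i σi) (excess vbar i w D) M ([], s) := by
  obtain ⟨δ, hδ, hδε, hgap⟩ := exists_gap vbar s (by positivity : 0 < ε / 4)
  set g : G.Step → ℝ := fun st => vbar s - δ - G.u i st.1 st.2 with hg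
  have hsub : goodSet i g ⊆ {s | w ≤ vbar s} := fun s' hs' =>
    hs.trans (hgap s' (le_of_mem_goodSet hv hs'))
  obtain ⟨K, hK, hgK⟩ := exists_abs_le g
  obtain ⟨σ', hσ'⟩ := exists_perturbation i g σ
    (lt_min zero_lt_one (by positivity) : 0 < min 1 (ε / (4 * (K + 1)))) (min_le_left _ _)
  obtain ⟨σi, hσi, hM⟩ := exists_reply hind hDi hP' hδ s σ'
  obtain ⟨hsure, hpert⟩ := hσ' s (fun τ => (exists_reply hind hDi hP' hδ s τ).imp fun _ h => h.1)
    σi hσi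
  obtain ⟨M, hM, hM1⟩ := (hM.and (eventually_ge_atTop 1)).exists
  have hsure' := (hsure M).mono hsub
  refine ⟨σi, M, hM1, hsure', fun ⟨D, hD⟩ => ?_⟩
  have hM0 : (0 : ℝ) ≤ M := Nat.cast_nonneg M
  by_cases hDw : ∃ s ∈ D, w ≤ vbar s
  swap
  · refine le_trans (by nlinarith) (partSum_nonneg_of_sure σ (fun st hst => ?_) hsure')
    rw [excess, if_neg hDw, if_neg fun h => hDw ⟨_, h, hst⟩]
  have h1 := hpert (fun st => (-1) * if st.1 ∈ D then vbar s - δ - G.u i st.1 st.2 else 0) K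
    (fun st => by
      split_ifs
      · rw [neg_one_mul, abs_neg]
        exact hgK st
      · simpa using hK) M
  rw [partSum_const_mul] at h1
  have h2 : min 1 (ε / (4 * (K + 1))) * (K + 1) ≤ ε / 4 := by
    refine (mul_le_mul_of_nonneg_right (min_le_right _ _) (by positivity)).trans_eq ?_
    field_simp
  have h3 : 0 < min 1 (ε / (4 * (K + 1))) := lt_min zero_lt_one (by positivity)
  have h4 : 2 * min 1 (ε / (4 * (K + 1))) * K ≤ ε / 2 := by linarith
  have h5 := partSum_mono (Function.update σ i σi)
    (f := fun st => (-1) * (if st.1 ∈ D then vbar s - δ - G.u i st.1 st.2 else 0) + (-δ))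
    (f' := excess vbar i w D) (fun st => by
      rw [excess, if_pos hDw]
      split_ifs <;> linarith) M ([], s)
  rw [partSum_add, partSum_one_const] at h5
  have h6 := mul_le_mul_of_nonneg_right h4 hM0
  have h7 := mul_le_mul_of_nonneg_right hδε.le hM0
  have h8 := hM D hD
  linarith

lemma tSet_nonneg {lam : ℝ} (h0 : 0 ≤ lam) (h1 : lam < 1) (s : G.S) (σ : G.Profile)
    (D : Finset G.S) : 0 ≤ tSet lam s σ D := by
  rw [tSet_eq h0 h1]
  exact disc_nonneg h0 h1 σ (fun st => by split_ifs <;> norm_num) _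

lemma IsPartitionF.sum_ite {Di : Finset (Finset G.S)} (hDi : IsPartitionF Di) (s : G.S) (x : ℝ) :
    ∑ D ∈ Di, (if s ∈ D then x else 0) = x := by
  obtain ⟨D, ⟨hD, hs⟩, huniq⟩ := hDi s
  rw [Finset.sum_eq_single_of_mem D hD fun D' hD' hne =>
    if_neg fun hs' => hne (huniq D' ⟨hD', hs'⟩), if_pos hs]

lemma IsPartitionF.sum_tSet {Di : Finset (Finset G.S)} (hDi : IsPartitionF Di) {lam : ℝ}
    (h0 : 0 ≤ lam) (h1 : lam < 1) (s : G.S) (σ : G.Profile) :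
    ∑ D ∈ Di, tSet lam s σ D = 1 := by
  simp only [tSet_eq h0 h1]
  rw [← disc_sum h0 h1]
  simp only [hDi.sum_ite]
  exact disc_one h0 h1 σ _

lemma IsPartitionF.sum_UD {Di : Finset (Finset G.S)} (hDi : IsPartitionF Di) {lam : ℝ}
    (h0 : 0 ≤ lam) (h1 : lam < 1) (s : G.S) (σ : G.Profile) (i : G.I) :
    ∑ D ∈ Di, UD lam s σ i D = payoffD lam s σ i := by
  simp only [UD_eq h0 h1]
  rw [← disc_sum h0 h1, payoffD_eq h0 h1]
  simp only [hDi.sum_ite]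

lemma neg_tSet_le_UD {lam : ℝ} (h0 : 0 ≤ lam) (h1 : lam < 1) (s : G.S) (σ : G.Profile) (i : G.I)
    (D : Finset G.S) : -tSet lam s σ D ≤ UD lam s σ i D := by
  have h2 := disc_mono h0 h1 σ (f := fun st => (-1) * if st.1 ∈ D then (1 : ℝ) else 0)
    (f' := fun st => if st.1 ∈ D then G.u i st.1 st.2 else 0) (fun st => by
      split_ifs
      · simpa using (abs_le.1 (G.u_bdd i st.1 st.2)).1
      · simp) ([], s)
  rw [disc_const_mul, ← tSet_eq h0 h1, ← UD_eq h0 h1] at h2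
  linarith

lemma modPayoff_le_payoffD {Di : Finset (Finset G.S)} (hDi : IsPartitionF Di) {lam : ℝ}
    (h0 : 0 ≤ lam) (h1 : lam < 1) (s : G.S) (σ : G.Profile) (i : G.I) (c : Finset G.S → ℝ) :
    modPayoff lam s σ i Di c ≤ payoffD lam s σ i := by
  rw [← hDi.sum_UD h0 h1]
  exact Finset.sum_le_sum fun D _ => min_le_left _ _

lemma neg_le_modPayoff {Di : Finset (Finset G.S)} (hDi : IsPartitionF Di) {lam : ℝ}
    (h0 : 0 ≤ lam) (h1 : lam < 1) (s : G.S) (σ : G.Profile) (i : G.I) (c : Finset G.S → ℝ) :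
    -∑ D ∈ Di, (1 + |c D|) ≤ modPayoff lam s σ i Di c := by
  rw [modPayoff, ← Finset.sum_neg_distrib]
  refine Finset.sum_le_sum fun D hD => ?_
  have h2 := tSet_nonneg h0 h1 s σ D
  have h3 : tSet lam s σ D ≤ 1 := by
    rw [← hDi.sum_tSet h0 h1 s σ]
    exact Finset.single_le_sum (fun D _ => tSet_nonneg h0 h1 s σ D) hD
  have h4 := neg_tSet_le_UD h0 h1 s σ i D
  have h5 := neg_abs_le (c D)
  have h6 := abs_nonneg (c D)
  refine le_min (by linarith) ?_
  nlinarith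

lemma bddAbove_modPayoff {Di : Finset (Finset G.S)} (hDi : IsPartitionF Di) {lam : ℝ}
    (h0 : 0 ≤ lam) (h1 : lam < 1) (s : G.S) (σ : G.Profile) (i : G.I) (c : Finset G.S → ℝ) :
    BddAbove (Set.range fun σi : G.BStrat i =>
      modPayoff lam s (Function.update σ i σi) i Di c) :=
  ⟨1, by
    rintro _ ⟨σi, rfl⟩
    exact (modPayoff_le_payoffD hDi h0 h1 s _ i c).trans
      (abs_le.1 (abs_payoffD_le h0 h1 s _ i)).2⟩

lemma minmaxMod_le_minmaxOrig {Di : Finset (Finset G.S)} (hDi : IsPartitionF Di) {lam : ℝ}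
    (h0 : 0 ≤ lam) (h1 : lam < 1) (s : G.S) (i : G.I) (c : Finset G.S → ℝ) :
    minmaxMod G lam s i Di c ≤ minmaxOrig G lam s i := by
  refine ciInf_mono ⟨-∑ D ∈ Di, (1 + |c D|), ?_⟩ fun σ => ?_
  · rintro _ ⟨σ, rfl⟩
    exact le_ciSup_of_le (bddAbove_modPayoff hDi h0 h1 s σ i c) (σ i)
      (neg_le_modPayoff hDi h0 h1 s _ i c)
  · have : Nonempty (G.BStrat i) := ⟨σ i⟩
    exact ciSup_mono (bddAbove_payoffD h0 h1 s σ i) fun σi =>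
      modPayoff_le_payoffD hDi h0 h1 s _ i c

/-- If the discounted excesses over the level `w` are almost nonnegative, then the modified payoff
is almost `w`. -/
lemma le_modPayoff_of_excess {vbar : G.S → ℝ} {i : G.I} {Di : Finset (Finset G.S)}
    (hDi : IsPartitionF Di) {c : Finset G.S → ℝ} (hc : ∀ D ∈ Di, ∀ s ∈ D, vbar s ≤ c D)
    {lam : ℝ} (h0 : 0 ≤ lam) (h1 : lam < 1) {w ε : ℝ} (hε : 0 < ε) (s : G.S) (σ : G.Profile)
    (h : ∀ D ∈ Di, -ε ≤ disc lam σ (excess vbar i w D) ([], s)) :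
    w - ε * ∑ D ∈ Di, (1 + |w| + |c D|) ≤ modPayoff lam s σ i Di c := by
  have h2 : w - ε * ∑ D ∈ Di, (1 + |w| + |c D|) =
      ∑ D ∈ Di, (w * tSet lam s σ D - ε * (1 + |w| + |c D|)) := by
    rw [Finset.sum_sub_distrib, ← Finset.mul_sum, ← Finset.mul_sum, hDi.sum_tSet h0 h1, mul_one]
  rw [h2, modPayoff]
  refine Finset.sum_le_sum fun D hD => ?_
  have ht := tSet_nonneg h0 h1 s σ D
  have h3 := h D hD
  have h4 : 0 ≤ ε * |w| := by positivity
  have h5 : 0 ≤ ε * |c D| := by positivity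
  by_cases hDw : ∃ s ∈ D, w ≤ vbar s
  · have h6 : excess vbar i w D = fun st => (if st.1 ∈ D then G.u i st.1 st.2 else 0) +
        (-w) * (if st.1 ∈ D then 1 else 0) := by
      ext st
      rw [excess, if_pos hDw]
      split_ifs <;> ring
    rw [h6, disc_add h0 h1, disc_const_mul, ← UD_eq h0 h1, ← tSet_eq h0 h1] at h3
    obtain ⟨s', hs', hw⟩ := hDw
    have h7 := mul_le_mul_of_nonneg_right (hw.trans (hc D hD s' hs')) ht
    exact le_min (by linarith) (by linarith)
  · have h6 : excess vbar i w D = fun st => (-1) * (if st.1 ∈ D then 1 else 0) := by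
      ext st
      rw [excess, if_neg hDw]
      split_ifs <;> ring
    rw [h6, disc_const_mul, ← tSet_eq h0 h1] at h3
    have h7 := neg_tSet_le_UD h0 h1 s σ i D
    have h8 : w * tSet lam s σ D ≤ ε * |w| := by
      nlinarith [mul_le_mul_of_nonneg_right (le_abs_self w) ht, abs_nonneg w]
    have h9 : -(ε * |c D|) ≤ tSet lam s σ D * c D := by
      nlinarith [mul_le_mul_of_nonneg_right (neg_abs_le (c D)) ht, abs_nonneg (c D)]
    exact le_min (by linarith) (by linarith)

end StocGame

end

open StocGame in
/-- if the partition `Di` satisfies Property P' with respect to player `i`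
and the cutoffs are at least the uniform min-max value on each element, then the min-max
value of player `i` in the modified game converges, as the discount factor goes to `1`,
to his uniform min-max value at the initial state. -/
theorem stmt_11 (G : StocGame) (μfam : G.S → G.Profile → Measure G.Play)
    (hind : IsInduced μfam) (i : G.I) (vbar : G.S → ℝ)
    (hv : ∀ s0 : G.S,
      Tendsto (fun lam => minmaxOrig G lam s0 i) (𝓝[<] (1 : ℝ)) (𝓝 (vbar s0)))
    (Di : Finset (Finset G.S)) (hDi : IsPartitionF Di)
    (hP' : PropertyP' μfam vbar i Di)
    (c : Finset G.S → ℝ) (hc : ∀ D ∈ Di, ∀ s ∈ D, vbar s ≤ c D) (s0 : G.S) :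
    Tendsto (fun lam => minmaxMod G lam s0 i Di c) (𝓝[<] (1 : ℝ)) (𝓝 (vbar s0)) := by
  have hlower : ∀ a < vbar s0, ∀ᶠ lam in 𝓝[<] (1 : ℝ), a < minmaxMod G lam s0 i Di c := by
    intro a ha
    set w := vbar s0
    set S := ∑ D ∈ Di, (1 + |w| + |c D|)
    have hS : 0 ≤ S := Finset.sum_nonneg fun D _ => by positivity
    obtain ⟨ε, hε, hεS⟩ : ∃ ε, 0 < ε ∧ a < w - ε * S := by
      refine ⟨(w - a) / (S + 1), div_pos (sub_pos.2 ha) (by positivity), ?_⟩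
      have h1 : (w - a) / (S + 1) * (S + 1) = w - a := div_mul_cancel₀ _ (by positivity)
      have h2 : 0 < (w - a) / (S + 1) := div_pos (sub_pos.2 ha) (by positivity)
      linarith
    have hev := eventually_disc_ge (fun D : Di => excess vbar i w D) i {s | w ≤ vbar s}
      (fun ε hε s hs σ => exists_excess_block hind hv hDi hP' hε hs σ) hε
    filter_upwards [hev, Ioo_mem_nhdsLT (zero_lt_one : (0 : ℝ) < 1)] with lam hlam ⟨h0, h1⟩
    refine hεS.trans_le (le_ciInf fun σ => ?_)
    obtain ⟨σi, hσi⟩ := hlam s0 (le_refl w) σ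
    exact le_ciSup_of_le (bddAbove_modPayoff hDi h0.le h1 s0 σ i c) σi
      (le_modPayoff_of_excess hDi hc h0.le h1 hε s0 _ fun D hD => hσi ⟨D, hD⟩)
  refine tendsto_order.2 ⟨hlower, fun a ha => ?_⟩
  filter_upwards [(tendsto_order.1 (hv s0)).2 a ha,
    Ioo_mem_nhdsLT (zero_lt_one : (0 : ℝ) < 1)] with lam hlam ⟨h0, h1⟩
  exact (minmaxMod_le_minmaxOrig hDi h0.le h1 s0 i c).trans_lt hlam
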